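/- arXiv:1301.3640 — 2 statements merged into one kernel-verified Lean document; each statement's English description precedes it below -/
import Mathlib

section
/- Let H₁, H₂, K₁, K₂ be Hilbert spaces, let φ be a weak* continuous completely bounded linear map on B(H₁,H₂), let V, V₁, …, V_n ⊆ B(H₁,H₂) and U, U₁, …, U_n ⊆ B(K₁,K₂) be weak* closed subspaces, and suppose V is invariant under φ. Write φ̃ = φ ⊗ id for the induced weak* continuous completely bounded map on B(H₁,H₂) ⊗̄ B(K₁,K₂). Then: (i) φ̃ maps the weak* closure of V₁ ⊗̄ U₁ + ⋯ + V_n ⊗̄ U_n into the weak* closure of cl(φ(V₁)) ⊗̄ U₁ + ⋯ + cl(φ(V_n)) ⊗̄ U_n (where cl denotes weak* closure); in particular φ̃ leaves V ⊗̄ U invariant. (ii) If φ is idempotent, then (ran φ ⊗̄ U) ∩ (V ⊗̄ U) = φ(V) ⊗̄ U = φ̃(V ⊗̄ U); in particular, the range of every weak* continuous completely bounded idempotent on B(H₁,H₂) possesses property S_σ. -/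
open scoped ComplexInnerProductSpace Pointwise
open Set MeasureTheory

noncomputable section

namespace OpSynth

/-! ### The σ-weak (weak*) topology on `B(H,K)` -/

/-- The σ-weak (weak*) topology on the space of bounded operators between Hilbert
spaces: the initial topology with respect to the functionals
`T ↦ ∑' n, ⟪η n, T (ξ n)⟫` associated to square-summable sequences `ξ`, `η`.
This is the weak* topology arising from the identification of `B(H,K)` with the
dual of the trace class operators. -/
def sigmaWeak (H K : Type*) [NormedAddCommGroup H] [InnerProductSpace ℂ H]
    [NormedAddCommGroup K] [InnerProductSpace ℂ K] :
    TopologicalSpace (H →L[ℂ] K) :=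
  ⨅ (ξ : ℕ → H) (η : ℕ → K) (_ : Summable fun n => ‖ξ n‖ ^ 2)
    (_ : Summable fun n => ‖η n‖ ^ 2),
    TopologicalSpace.induced
      (fun T : H →L[ℂ] K => ∑' n, ⟪η n, T (ξ n)⟫) inferInstance

section Basic

variable {H K H₁ H₂ H₃ K₁ K₂ T₁ T₂ : Type*}
  [NormedAddCommGroup H] [InnerProductSpace ℂ H]
  [NormedAddCommGroup K] [InnerProductSpace ℂ K]
  [NormedAddCommGroup H₁] [InnerProductSpace ℂ H₁]
  [NormedAddCommGroup H₂] [InnerProductSpace ℂ H₂]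
  [NormedAddCommGroup H₃] [InnerProductSpace ℂ H₃]
  [NormedAddCommGroup K₁] [InnerProductSpace ℂ K₁]
  [NormedAddCommGroup K₂] [InnerProductSpace ℂ K₂]
  [NormedAddCommGroup T₁] [InnerProductSpace ℂ T₁]
  [NormedAddCommGroup T₂] [InnerProductSpace ℂ T₂]

/-- A set of operators is weak* closed if it is closed in the σ-weak topology. -/
def WkClosed (S : Set (H →L[ℂ] K)) : Prop :=
  @IsClosed _ (sigmaWeak H K) S

/-- The weak* closure of a set of operators. -/
def wkClosure (S : Set (H →L[ℂ] K)) : Set (H →L[ℂ] K) :=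
  @closure _ (sigmaWeak H K) S

/-- A weak* closed (linear) subspace of `B(H,K)`. -/
def IsWkClosedSubspace (S : Set (H →L[ℂ] K)) : Prop :=
  (∃ M : Submodule ℂ (H →L[ℂ] K), (M : Set (H →L[ℂ] K)) = S) ∧ WkClosed S

/-- A map between operator spaces is weak* continuous if it is continuous with
respect to the σ-weak topologies. -/
def WkContinuous (φ : (H₁ →L[ℂ] H₂) → (K₁ →L[ℂ] K₂)) : Prop :=
  @Continuous _ _ (sigmaWeak H₁ H₂) (sigmaWeak K₁ K₂) φ

/-- The norm of an `n × n` matrix of operators, viewed as an operator on the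
column Hilbert space `ℓ²(Fin n, H)`: the supremum over the unit ball of the
ℓ²-norm of the image. -/
def blockNorm {n : ℕ} (M : Matrix (Fin n) (Fin n) (H →L[ℂ] K)) : ℝ :=
  sSup { r | ∃ v : Fin n → H, (∑ j, ‖v j‖ ^ 2) ≤ 1 ∧
    r = Real.sqrt (∑ i, ‖∑ j, M i j (v j)‖ ^ 2) }

/-- A map `φ : B(H₁,H₂) → B(K₁,K₂)` is completely bounded if its matrix
amplifications are uniformly bounded. -/
def CompletelyBounded (φ : (H₁ →L[ℂ] H₂) → (K₁ →L[ℂ] K₂)) : Prop :=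
  ∃ C : ℝ, 0 ≤ C ∧ ∀ (n : ℕ) (M : Matrix (Fin n) (Fin n) (H₁ →L[ℂ] H₂)),
    blockNorm (M.map φ) ≤ C * blockNorm M

/-- `t : H → K → T₁` realizes `T₁` as the Hilbertian tensor product `H ⊗ K`:
`t` is bilinear, multiplicative for inner products, and has total range. -/
def IsTensorEmbedding (t : H → K → T₁) : Prop :=
  (∀ x x' y, t (x + x') y = t x y + t x' y) ∧
  (∀ x y y', t x (y + y') = t x y + t x y') ∧
  (∀ (c : ℂ) x y, t (c • x) y = c • t x y) ∧
  (∀ (c : ℂ) x y, t x (c • y) = c • t x y) ∧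
  (∀ x x' y y', ⟪t x y, t x' y'⟫ = ⟪x, x'⟫ * ⟪y, y'⟫) ∧
  (Submodule.span ℂ { z | ∃ x y, z = t x y }).topologicalClosure = ⊤

/-- `W` is the elementary tensor `S ⊗ R` of the operators `S` and `R`, relative
to the tensor product realizations `t₁`, `t₂`. -/
def IsElemTensor (t₁ : H₁ → K₁ → T₁) (t₂ : H₂ → K₂ → T₂)
    (W : T₁ →L[ℂ] T₂) (S : H₁ →L[ℂ] H₂) (R : K₁ →L[ℂ] K₂) : Prop :=
  ∀ x y, W (t₁ x y) = t₂ (S x) (R y)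

/-- The weak* closed tensor product `V ⊗̄ U`: the weak* closed subspace generated
by the elementary tensors `S ⊗ R` with `S ∈ V`, `R ∈ U`. -/
def wTensor (t₁ : H₁ → K₁ → T₁) (t₂ : H₂ → K₂ → T₂)
    (V : Set (H₁ →L[ℂ] H₂)) (U : Set (K₁ →L[ℂ] K₂)) : Set (T₁ →L[ℂ] T₂) :=
  wkClosure ↑(Submodule.span ℂ
    { W : T₁ →L[ℂ] T₂ | ∃ S ∈ V, ∃ R ∈ U, IsElemTensor t₁ t₂ W S R })

/-- The Fubini product `F(V,U) = (V ⊗̄ B(K₁,K₂)) ∩ (B(H₁,H₂) ⊗̄ U)`. -/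
def Fubini (t₁ : H₁ → K₁ → T₁) (t₂ : H₂ → K₂ → T₂)
    (V : Set (H₁ →L[ℂ] H₂)) (U : Set (K₁ →L[ℂ] K₂)) : Set (T₁ →L[ℂ] T₂) :=
  wTensor t₁ t₂ V univ ∩ wTensor t₁ t₂ univ U

/-- Sum of finitely many subsets of an additive monoid. -/
def setSum {α : Type*} [AddCommMonoid α] {n : ℕ} (S : Fin n → Set α) : Set α :=
  { x | ∃ f : Fin n → α, (∀ i, f i ∈ S i) ∧ x = ∑ i, f i }

/-- The reflexive hull `Ref W = {T : Tx ∈ closure (W x) for all x}`. -/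
def RefHull (W : Set (H →L[ℂ] K)) : Set (H →L[ℂ] K) :=
  { T | ∀ x : H, T x ∈ closure ((fun S : H →L[ℂ] K => S x) '' W) }

end Basic

/-- Property `S_σ`: `F(V,U) = V ⊗̄ U` for every weak* closed subspace `U` of
`B(K₁,K₂)`, all Hilbert spaces `K₁`, `K₂`, and all realizations of the
corresponding Hilbertian tensor products. -/
def HasSsigma {H₁ H₂ : Type*}
    [NormedAddCommGroup H₁] [InnerProductSpace ℂ H₁]
    [NormedAddCommGroup H₂] [InnerProductSpace ℂ H₂]
    (V : Set (H₁ →L[ℂ] H₂)) : Prop :=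
  ∀ (K₁ K₂ T₁ T₂ : Type)
    [NormedAddCommGroup K₁] [InnerProductSpace ℂ K₁] [CompleteSpace K₁]
    [NormedAddCommGroup K₂] [InnerProductSpace ℂ K₂] [CompleteSpace K₂]
    [NormedAddCommGroup T₁] [InnerProductSpace ℂ T₁] [CompleteSpace T₁]
    [NormedAddCommGroup T₂] [InnerProductSpace ℂ T₂] [CompleteSpace T₂]
    (t₁ : H₁ → K₁ → T₁) (t₂ : H₂ → K₂ → T₂),
    IsTensorEmbedding t₁ → IsTensorEmbedding t₂ →
    ∀ U : Set (K₁ →L[ℂ] K₂), IsWkClosedSubspace U →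
      Fubini t₁ t₂ V U = wTensor t₁ t₂ V U

section Masa

variable {H H₁ H₂ H₃ : Type*}
  [NormedAddCommGroup H] [InnerProductSpace ℂ H] [CompleteSpace H]
  [NormedAddCommGroup H₁] [InnerProductSpace ℂ H₁] [CompleteSpace H₁]
  [NormedAddCommGroup H₂] [InnerProductSpace ℂ H₂] [CompleteSpace H₂]
  [NormedAddCommGroup H₃] [InnerProductSpace ℂ H₃] [CompleteSpace H₃]

/-- A masa: a maximal abelian selfadjoint subalgebra of `B(H)`. -/
def IsMasa (D : StarSubalgebra ℂ (H →L[ℂ] H)) : Prop :=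
  (∀ a ∈ D, ∀ b ∈ D, a * b = b * a) ∧
  ∀ E : StarSubalgebra ℂ (H →L[ℂ] H),
    (∀ a ∈ E, ∀ b ∈ E, a * b = b * a) → D ≤ E → E = D

/-- A (weak* closed) `D₂,D₁`-masa-bimodule. -/
def IsMasaBimodule (D₁ : StarSubalgebra ℂ (H₁ →L[ℂ] H₁))
    (D₂ : StarSubalgebra ℂ (H₂ →L[ℂ] H₂)) (V : Set (H₁ →L[ℂ] H₂)) : Prop :=
  IsWkClosedSubspace V ∧
  ∀ X ∈ V, ∀ A ∈ D₁, ∀ B ∈ D₂, B ∘L X ∘L A ∈ V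

/-- A ternary set of operators: closed under the triple product `T S* R`. -/
def IsTernary (M : Set (H₁ →L[ℂ] H₂)) : Prop :=
  ∀ T ∈ M, ∀ S ∈ M, ∀ R ∈ M, T ∘L (ContinuousLinearMap.adjoint S) ∘L R ∈ M

/-- An orthogonal projection. -/
def IsProj (p : H →L[ℂ] H) : Prop := p ∘L p = p ∧ IsSelfAdjoint p

/-- A minimal non-zero projection of a masa. -/
def IsMinimalProjOf (D : StarSubalgebra ℂ (H →L[ℂ] H)) (p : H →L[ℂ] H) : Prop :=
  p ∈ D ∧ IsProj p ∧ p ≠ 0 ∧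
    ∀ q ∈ D, IsProj q → p ∘L q = q → q = 0 ∨ q = p

/-- A projection in a masa is non-atomic if it dominates no minimal non-zero
projection of the masa. -/
def IsNonAtomicProj (D : StarSubalgebra ℂ (H →L[ℂ] H)) (E : H →L[ℂ] H) : Prop :=
  ∀ p, IsMinimalProjOf D p → ¬ (E ∘L p = p)

/-- A `D₂,D₁`-masa-bimodule map. -/
def IsMasaBimoduleMap (D₁ : StarSubalgebra ℂ (H₁ →L[ℂ] H₁))
    (D₂ : StarSubalgebra ℂ (H₂ →L[ℂ] H₂))
    (φ : (H₁ →L[ℂ] H₂) → (H₁ →L[ℂ] H₂)) : Prop :=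
  ∀ (X : H₁ →L[ℂ] H₂), ∀ A ∈ D₁, ∀ B ∈ D₂,
    φ (B ∘L X ∘L A) = B ∘L (φ X) ∘L A

/-- A Schur idempotent: a weak* continuous completely bounded idempotent
masa-bimodule map. -/
def IsSchurIdempotent (D₁ : StarSubalgebra ℂ (H₁ →L[ℂ] H₁))
    (D₂ : StarSubalgebra ℂ (H₂ →L[ℂ] H₂))
    (φ : (H₁ →L[ℂ] H₂) → (H₁ →L[ℂ] H₂)) : Prop :=
  IsLinearMap ℂ φ ∧ WkContinuous φ ∧ CompletelyBounded φ ∧ φ ∘ φ = φ ∧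
    IsMasaBimoduleMap D₁ D₂ φ

/-- A nest: a totally ordered family of closed subspaces containing the
intersection and the closed linear span of any of its subsets. -/
def IsNest (N : Set (Submodule ℂ H)) : Prop :=
  (∀ p ∈ N, IsClosed (p : Set H)) ∧ IsChain (· ≤ ·) N ∧
  ∀ S : Set (Submodule ℂ H), S ⊆ N →
    sInf S ∈ N ∧ (sSup S).topologicalClosure ∈ N

/-- The nest algebra of a nest: all operators leaving each subspace invariant. -/
def nestAlg (N : Set (Submodule ℂ H)) : Set (H →L[ℂ] H) :=
  { T | ∀ p ∈ N, ∀ x ∈ p, T x ∈ p }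

/-- A (weak* closed) nest algebra bimodule. -/
def IsNestBimodule (V : Set (H₁ →L[ℂ] H₂)) : Prop :=
  IsWkClosedSubspace V ∧
  ∃ (N₁ : Set (Submodule ℂ H₁)) (N₂ : Set (Submodule ℂ H₂)),
    IsNest N₁ ∧ IsNest N₂ ∧
    ∀ X ∈ V, ∀ A ∈ nestAlg N₁, ∀ B ∈ nestAlg N₂, B ∘L X ∘L A ∈ V

/-- A masa-bimodule of finite width: a finite intersection of masa-bimodules
each of which is a nest algebra bimodule. -/
def HasFiniteWidth (D₁ : StarSubalgebra ℂ (H₁ →L[ℂ] H₁))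
    (D₂ : StarSubalgebra ℂ (H₂ →L[ℂ] H₂)) (V : Set (H₁ →L[ℂ] H₂)) : Prop :=
  ∃ (k : ℕ) (Vs : Fin k → Set (H₁ →L[ℂ] H₂)),
    (∀ j, IsMasaBimodule D₁ D₂ (Vs j) ∧ IsNestBimodule (Vs j)) ∧
    V = ⋂ j, Vs j

end Masa

section Algebras

variable {H H₁ H₂ H₃ K : Type*}
  [NormedAddCommGroup H] [InnerProductSpace ℂ H] [CompleteSpace H]
  [NormedAddCommGroup H₁] [InnerProductSpace ℂ H₁] [CompleteSpace H₁]
  [NormedAddCommGroup H₂] [InnerProductSpace ℂ H₂] [CompleteSpace H₂]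
  [NormedAddCommGroup H₃] [InnerProductSpace ℂ H₃] [CompleteSpace H₃]

/-- A weak* closed unital operator algebra in `B(H)`. -/
def IsWkClosedUnitalAlg (A : Set (H →L[ℂ] H)) : Prop :=
  IsWkClosedSubspace A ∧ (1 : H →L[ℂ] H) ∈ A ∧ ∀ a ∈ A, ∀ b ∈ A, a ∘L b ∈ A

/-- `[X Y]`: the weak* closed linear span of the products `x ∘ y`. -/
def mulSpan (X : Set (H₂ →L[ℂ] H₃)) (Y : Set (H₁ →L[ℂ] H₂)) :
    Set (H₁ →L[ℂ] H₃) :=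
  wkClosure ↑(Submodule.span ℂ { T : H₁ →L[ℂ] H₃ | ∃ x ∈ X, ∃ y ∈ Y, T = x ∘L y })

/-- The data witnessing a spatial embedding of `A` into `B`. -/
def SpatialPair (A : Set (H₁ →L[ℂ] H₁)) (B : Set (H₂ →L[ℂ] H₂))
    (X : Set (H₁ →L[ℂ] H₂)) (Y : Set (H₂ →L[ℂ] H₁)) : Prop :=
  IsWkClosedSubspace X ∧ IsWkClosedSubspace Y ∧
  (∀ x ∈ X, ∀ b ∈ B, ∀ a ∈ A, b ∘L x ∘L a ∈ X) ∧
  (∀ y ∈ Y, ∀ a ∈ A, ∀ b ∈ B, a ∘L y ∘L b ∈ Y) ∧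
  mulSpan X Y ⊆ B ∧ mulSpan Y X = A

/-- `A` is spatially embedded in `B`. -/
def SpatiallyEmbedded (A : Set (H₁ →L[ℂ] H₁)) (B : Set (H₂ →L[ℂ] H₂)) : Prop :=
  ∃ X Y, SpatialPair A B X Y

/-- `A` and `B` are spatially Morita equivalent. -/
def SpatiallyMorita (A : Set (H₁ →L[ℂ] H₁)) (B : Set (H₂ →L[ℂ] H₂)) : Prop :=
  ∃ X Y, SpatialPair A B X Y ∧ mulSpan X Y = B

/-- The strong operator topology on `B(H,K)`. -/
def sot (H K : Type*) [NormedAddCommGroup H] [InnerProductSpace ℂ H]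
    [NormedAddCommGroup K] [InnerProductSpace ℂ K] :
    TopologicalSpace (H →L[ℂ] K) :=
  TopologicalSpace.induced (fun T : H →L[ℂ] K => (T : H → K)) Pi.topologicalSpace

/-- A commutative subspace lattice (CSL): a strongly closed lattice of mutually
commuting orthogonal projections containing `0` and `1`. -/
def IsCSL (L : Set (H →L[ℂ] H)) : Prop :=
  (∀ P ∈ L, IsProj P) ∧
  (∀ P ∈ L, ∀ Q ∈ L, P ∘L Q = Q ∘L P) ∧
  (0 : H →L[ℂ] H) ∈ L ∧ (1 : H →L[ℂ] H) ∈ L ∧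
  (∀ P ∈ L, ∀ Q ∈ L, P ∘L Q ∈ L ∧ P + Q - P ∘L Q ∈ L) ∧
  @IsClosed _ (sot H H) L

/-- The CSL algebra `Alg L = {T : (1 - P) T P = 0 for all P ∈ L}`. -/
def cslAlg (L : Set (H →L[ℂ] H)) : Set (H →L[ℂ] H) :=
  { T | ∀ P ∈ L, (1 - P) ∘L T ∘L P = 0 }

/-- A lattice homomorphism between CSLs (preserving meets and joins). -/
def IsLatticeHom (L₁ : Set (H₁ →L[ℂ] H₁)) (L₂ : Set (H₂ →L[ℂ] H₂))
    (φ : (H₁ →L[ℂ] H₁) → (H₂ →L[ℂ] H₂)) : Prop :=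
  MapsTo φ L₁ L₂ ∧
  (∀ P ∈ L₁, ∀ Q ∈ L₁, φ (P ∘L Q) = φ P ∘L φ Q) ∧
  (∀ P ∈ L₁, ∀ Q ∈ L₁, φ (P + Q - P ∘L Q) = φ P + φ Q - φ P ∘L φ Q)

end Algebras

section MeasurePart

variable {X X₁ X₂ : Type*} [MeasurableSpace X] [MeasurableSpace X₁] [MeasurableSpace X₂]

/-- A subset of a product of measure spaces is marginally null if it is
contained in `(M₁ × X₂) ∪ (X₁ × M₂)` with `μ₁ M₁ = μ₂ M₂ = 0`. -/
def MargNull (μ₁ : Measure X₁) (μ₂ : Measure X₂) (E : Set (X₁ × X₂)) : Prop :=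
  ∃ (M₁ : Set X₁) (M₂ : Set X₂), MeasurableSet M₁ ∧ MeasurableSet M₂ ∧
    μ₁ M₁ = 0 ∧ μ₂ M₂ = 0 ∧
    E ⊆ (M₁ ×ˢ (univ : Set X₂)) ∪ ((univ : Set X₁) ×ˢ M₂)

/-- Marginal equivalence: the symmetric difference is marginally null. -/
def MargEquiv (μ₁ : Measure X₁) (μ₂ : Measure X₂) (E F : Set (X₁ × X₂)) : Prop :=
  MargNull μ₁ μ₂ ((E \ F) ∪ (F \ E))

/-- ω-open sets: marginally equivalent to a countable union of measurable
rectangles. -/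
def OmegaOpen (μ₁ : Measure X₁) (μ₂ : Measure X₂) (E : Set (X₁ × X₂)) : Prop :=
  ∃ (α : ℕ → Set X₁) (β : ℕ → Set X₂),
    (∀ n, MeasurableSet (α n)) ∧ (∀ n, MeasurableSet (β n)) ∧
    MargEquiv μ₁ μ₂ E (⋃ n, (α n) ×ˢ (β n))

/-- ω-closed sets: complements of ω-open sets. -/
def OmegaClosed (μ₁ : Measure X₁) (μ₂ : Measure X₂) (E : Set (X₁ × X₂)) : Prop :=
  OmegaOpen μ₁ μ₂ Eᶜ

/-- `A` is a multiplication operator on `L²(X,μ)`: `A f = φ · f` for some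
essentially bounded function `φ`.  The collection `{A | IsMultOp μ A}` is the
multiplication masa of `L^∞(X,μ)`. -/
def IsMultOp (μ : Measure X) (A : Lp ℂ 2 μ →L[ℂ] Lp ℂ 2 μ) : Prop :=
  ∃ φ : X → ℂ, AEStronglyMeasurable φ μ ∧ (∃ C, ∀ᵐ x ∂μ, ‖φ x‖ ≤ C) ∧
    ∀ f : Lp ℂ 2 μ, ⇑(A f) =ᵐ[μ] fun x => φ x * f x

/-- A (weak* closed) masa-bimodule over the multiplication masas. -/
def IsMultBimodule (μ₁ : Measure X₁) (μ₂ : Measure X₂)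
    (V : Set (Lp ℂ 2 μ₁ →L[ℂ] Lp ℂ 2 μ₂)) : Prop :=
  IsWkClosedSubspace V ∧
  ∀ X ∈ V, ∀ (A : Lp ℂ 2 μ₁ →L[ℂ] Lp ℂ 2 μ₁) (B : Lp ℂ 2 μ₂ →L[ℂ] Lp ℂ 2 μ₂),
    IsMultOp μ₁ A → IsMultOp μ₂ B → B ∘L X ∘L A ∈ V

/-- `T` is supported on `κ`: `M_{χ_β} T M_{χ_α} = 0` (equivalently,
`⟪T f, g⟫ = 0` whenever `f` vanishes off `α` and `g` vanishes off `β`)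
whenever the rectangle `α × β` intersects `κ` marginally nullly. -/
def SupportedOn (μ₁ : Measure X₁) (μ₂ : Measure X₂) (κ : Set (X₁ × X₂))
    (T : Lp ℂ 2 μ₁ →L[ℂ] Lp ℂ 2 μ₂) : Prop :=
  ∀ (α : Set X₁) (β : Set X₂), MeasurableSet α → MeasurableSet β →
    MargNull μ₁ μ₂ ((α ×ˢ β) ∩ κ) →
    ∀ (f : Lp ℂ 2 μ₁) (g : Lp ℂ 2 μ₂),
      (∀ᵐ x ∂μ₁, x ∉ α → f x = 0) → (∀ᵐ y ∂μ₂, y ∉ β → g y = 0) →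
      ⟪T f, g⟫ = (0 : ℂ)

/-- `M_max κ`: the space of all operators supported on `κ` — the largest
masa-bimodule with support `κ`. -/
def Mmax (μ₁ : Measure X₁) (μ₂ : Measure X₂) (κ : Set (X₁ × X₂)) :
    Set (Lp ℂ 2 μ₁ →L[ℂ] Lp ℂ 2 μ₂) :=
  { T | SupportedOn μ₁ μ₂ κ T }

/-- `U` has support `κ`: `κ` is ω-closed and `Ref U = M_max κ`. -/
def HasSupport (μ₁ : Measure X₁) (μ₂ : Measure X₂)
    (U : Set (Lp ℂ 2 μ₁ →L[ℂ] Lp ℂ 2 μ₂)) (κ : Set (X₁ × X₂)) : Prop :=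
  OmegaClosed μ₁ μ₂ κ ∧ RefHull U = Mmax μ₁ μ₂ κ

/-- `M_min κ`: the smallest weak* closed masa-bimodule with support `κ`,
realized as the intersection of all weak* closed masa-bimodules with support `κ`. -/
def Mmin (μ₁ : Measure X₁) (μ₂ : Measure X₂) (κ : Set (X₁ × X₂)) :
    Set (Lp ℂ 2 μ₁ →L[ℂ] Lp ℂ 2 μ₂) :=
  ⋂₀ { U | IsMultBimodule μ₁ μ₂ U ∧ HasSupport μ₁ μ₂ U κ }

/-- `κ` is operator synthetic if it is ω-closed and `M_min κ = M_max κ`. -/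
def OperatorSynthetic (μ₁ : Measure X₁) (μ₂ : Measure X₂)
    (κ : Set (X₁ × X₂)) : Prop :=
  OmegaClosed μ₁ μ₂ κ ∧ Mmin μ₁ μ₂ κ = Mmax μ₁ μ₂ κ

/-- A masa-bimodule of finite width over the multiplication masas. -/
def MultFiniteWidth (μ₁ : Measure X₁) (μ₂ : Measure X₂)
    (V : Set (Lp ℂ 2 μ₁ →L[ℂ] Lp ℂ 2 μ₂)) : Prop :=
  ∃ (k : ℕ) (Vs : Fin k → Set (Lp ℂ 2 μ₁ →L[ℂ] Lp ℂ 2 μ₂)),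
    (∀ j, IsMultBimodule μ₁ μ₂ (Vs j) ∧ IsNestBimodule (Vs j)) ∧
    V = ⋂ j, Vs j

/-- A set of finite width: the support of a masa-bimodule of finite width. -/
def FiniteWidthSet (μ₁ : Measure X₁) (μ₂ : Measure X₂)
    (κ : Set (X₁ × X₂)) : Prop :=
  ∃ V, MultFiniteWidth μ₁ μ₂ V ∧ HasSupport μ₁ μ₂ V κ

end MeasurePart

/-- The flip `ρ : (X₁ × X₂) × (Y₁ × Y₂) → (X₁ × Y₁) × (X₂ × Y₂)`. -/
def flipProd {X₁ X₂ Y₁ Y₂ : Type*} :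
    (X₁ × X₂) × (Y₁ × Y₂) → (X₁ × Y₁) × (X₂ × Y₂) :=
  fun q => ((q.1.1, q.2.1), (q.1.2, q.2.2))

end OpSynth

namespace OpSynth

section Helpers

open Filter Topology

variable {H K H' K' : Type*}
  [NormedAddCommGroup H] [InnerProductSpace ℂ H]
  [NormedAddCommGroup K] [InnerProductSpace ℂ K]
  [NormedAddCommGroup H'] [InnerProductSpace ℂ H']
  [NormedAddCommGroup K'] [InnerProductSpace ℂ K']

/-- `ω` is represented by square summable sequences with total mass `r`. -/
def NRep (ω : (H →L[ℂ] K) →ₗ[ℂ] ℂ) (r : ℝ) : Prop :=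
  ∃ (ξ : ℕ → H) (η : ℕ → K), HasSum (fun i => ‖ξ i‖ ^ 2 + ‖η i‖ ^ 2) r ∧
    ∀ T, HasSum (fun i => ⟪η i, T (ξ i)⟫) (ω T)

lemma norm_pair_le (T : H →L[ℂ] K) (x : H) (y : K) :
    ‖⟪y, T x⟫‖ ≤ ‖T‖ * (‖x‖ ^ 2 + ‖y‖ ^ 2) := by
  have h1 := norm_inner_le_norm (𝕜 := ℂ) y (T x)
  have h2 := T.le_opNorm x
  have h3 : ‖y‖ * ‖T x‖ ≤ ‖y‖ * (‖T‖ * ‖x‖) := by gcongr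
  have h4 : ‖y‖ * (‖T‖ * ‖x‖) = ‖T‖ * (‖x‖ * ‖y‖) := by ring
  have h5 : ‖x‖ * ‖y‖ ≤ ‖x‖ ^ 2 + ‖y‖ ^ 2 := by
    nlinarith [sq_nonneg (‖x‖ - ‖y‖), sq_nonneg (‖x‖ + ‖y‖)]
  have h6 : ‖T‖ * (‖x‖ * ‖y‖) ≤ ‖T‖ * (‖x‖ ^ 2 + ‖y‖ ^ 2) := by gcongr
  linarith

lemma summable_pair {ι : Type*} {ξ : ι → H} {η : ι → K}
    (h : Summable (fun i => ‖ξ i‖ ^ 2 + ‖η i‖ ^ 2)) (T : H →L[ℂ] K) :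
    Summable (fun i => ⟪η i, T (ξ i)⟫) :=
  Summable.of_norm_bounded (h.mul_left ‖T‖) (fun i => norm_pair_le T _ _)

lemma hasSum_of_eq {ι E : Type*} [AddCommMonoid E] [TopologicalSpace E] {f g : ι → E} {a : E}
    (h : ∀ i, f i = g i) (hg : HasSum g a) : HasSum f a := by
  rwa [funext h]

lemma NRep.of_countable {ι : Type*} [Countable ι] {ω : (H →L[ℂ] K) →ₗ[ℂ] ℂ} {r : ℝ}
    (ξ : ι → H) (η : ι → K) (h : HasSum (fun i => ‖ξ i‖ ^ 2 + ‖η i‖ ^ 2) r)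
    (hT : ∀ T, HasSum (fun i => ⟪η i, T (ξ i)⟫) (ω T)) : NRep ω r := by
  obtain ⟨e, he⟩ := exists_injective_nat ι
  refine ⟨Function.extend e ξ 0, Function.extend e η 0, ?_, fun T => ?_⟩
  · rw [← hasSum_extend_zero he] at h
    convert h using 2 with n
    by_cases hn : ∃ i, e i = n
    · obtain ⟨i, rfl⟩ := hn
      simp [he.extend_apply]
    · simp [Function.extend_apply' _ _ _ hn]
  · have h := hT T
    rw [← hasSum_extend_zero he] at h
    convert h using 2 with n
    by_cases hn : ∃ i, e i = n
    · obtain ⟨i, rfl⟩ := hn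
      simp [he.extend_apply]
    · simp [Function.extend_apply' _ _ _ hn]

lemma NRep.nonneg {ω : (H →L[ℂ] K) →ₗ[ℂ] ℂ} {r : ℝ} (h : NRep ω r) : 0 ≤ r := by
  obtain ⟨ξ, η, h, -⟩ := h
  exact h.nonneg (fun i => by positivity)

lemma NRep.bound {ω : (H →L[ℂ] K) →ₗ[ℂ] ℂ} {r : ℝ} (h : NRep ω r) (T : H →L[ℂ] K) :
    ‖ω T‖ ≤ ‖T‖ * r := by
  obtain ⟨ξ, η, h, hT⟩ := h
  rw [← (hT T).tsum_eq]
  exact tsum_of_norm_bounded (h.mul_left ‖T‖) (fun i => norm_pair_le T _ _)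

lemma NRep.zero : NRep (0 : (H →L[ℂ] K) →ₗ[ℂ] ℂ) 0 :=
  ⟨0, 0, by simpa using hasSum_zero, fun T => by simpa using hasSum_zero⟩

lemma NRep.smul {ω : (H →L[ℂ] K) →ₗ[ℂ] ℂ} {r : ℝ} (h : NRep ω r) (c : ℂ) :
    NRep (c • ω) (‖c‖ * r) := by
  obtain ⟨ξ, η, h, hT⟩ := h
  have hs : Real.sqrt ‖c‖ ^ 2 = ‖c‖ := Real.sq_sqrt (norm_nonneg _)
  have key : ∃ b : ℂ, ‖b‖ ^ 2 = ‖c‖ ∧ starRingEnd ℂ b * (Real.sqrt ‖c‖ : ℂ) = c := by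
    by_cases hc : c = 0
    · exact ⟨0, by simp [hc], by simp [hc]⟩
    · have hpos : 0 < Real.sqrt ‖c‖ := Real.sqrt_pos.2 (norm_pos_iff.2 hc)
      have hne : (Real.sqrt ‖c‖ : ℂ) ≠ 0 := by exact_mod_cast hpos.ne'
      refine ⟨starRingEnd ℂ (c / (Real.sqrt ‖c‖ : ℂ)), ?_, ?_⟩
      · rw [RCLike.norm_conj, norm_div, Complex.norm_real, Real.norm_of_nonneg hpos.le, div_pow, hs]
        field_simp [norm_pos_iff.2 hc]
      · simp only [Complex.conj_conj]; field_simp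
  obtain ⟨b, hb, hbc⟩ := key
  refine ⟨fun i => (Real.sqrt ‖c‖ : ℂ) • ξ i, fun i => b • η i, ?_, fun T => ?_⟩
  · refine hasSum_of_eq (fun i => ?_) (h.mul_left ‖c‖)
    rw [norm_smul, norm_smul, mul_pow, mul_pow, hb, Complex.norm_real,
      Real.norm_of_nonneg (Real.sqrt_nonneg _), hs]
    ring
  · refine hasSum_of_eq (fun i => ?_) ((hT T).mul_left c)
    rw [map_smul, inner_smul_left, inner_smul_right, ← mul_assoc, hbc]

lemma NRep.hasSum {ω : ℕ → (H →L[ℂ] K) →ₗ[ℂ] ℂ} {r : ℕ → ℝ} (h : ∀ k, NRep (ω k) (r k))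
    (hr : Summable r) (Ω : (H →L[ℂ] K) →ₗ[ℂ] ℂ) (hΩ : ∀ T, HasSum (fun k => ω k T) (Ω T)) :
    NRep Ω (∑' k, r k) := by
  choose ξ η h hT using h
  have hs : Summable (fun p : Σ _ : ℕ, ℕ => ‖ξ p.1 p.2‖ ^ 2 + ‖η p.1 p.2‖ ^ 2) := by
    rw [summable_sigma_of_nonneg (fun p => by positivity)]
    exact ⟨fun k => (h k).summable, by simpa [fun k => (h k).tsum_eq] using hr⟩
  refine NRep.of_countable (ι := Σ _ : ℕ, ℕ) (fun p => ξ p.1 p.2) (fun p => η p.1 p.2) ?_ fun T => ?_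
  · have := hs.hasSum.sigma (fun k => h k)
    rw [this.tsum_eq]
    exact hs.hasSum
  · have := summable_pair (ξ := fun p : Σ _ : ℕ, ℕ => ξ p.1 p.2)
      (η := fun p : Σ _ : ℕ, ℕ => η p.1 p.2) hs T
    rw [← (hΩ T).tsum_eq, (this.hasSum.sigma (fun k => hT k T)).tsum_eq]
    exact this.hasSum

lemma NRep.add {ω ω' : (H →L[ℂ] K) →ₗ[ℂ] ℂ} {r r' : ℝ} (h : NRep ω r) (h' : NRep ω' r') :
    NRep (ω + ω') (r + r') := by
  obtain ⟨ξ, η, h, hT⟩ := h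
  obtain ⟨ξ', η', h', hT'⟩ := h'
  refine NRep.of_countable (ι := ℕ ⊕ ℕ) (Sum.elim ξ ξ') (Sum.elim η η') ?_ fun T => ?_
  · exact HasSum.sum (f := fun i => ‖Sum.elim ξ ξ' i‖ ^ 2 + ‖Sum.elim η η' i‖ ^ 2)
      (by simpa [Function.comp_def] using h) (by simpa [Function.comp_def] using h')
  · exact HasSum.sum (f := fun i => ⟪Sum.elim η η' i, T (Sum.elim ξ ξ' i)⟫)
      (by simpa [Function.comp_def] using hT T) (by simpa [Function.comp_def] using hT' T)

variable (H K) in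
/-- The space of normal functionals. -/
def Nrm : Submodule ℂ ((H →L[ℂ] K) →ₗ[ℂ] ℂ) where
  carrier := {ω | ∃ r, NRep ω r}
  zero_mem' := ⟨0, NRep.zero⟩
  add_mem' := fun ⟨_, h⟩ ⟨_, h'⟩ => ⟨_, h.add h'⟩
  smul_mem' := fun c _ ⟨_, h⟩ => ⟨_, h.smul c⟩

lemma mem_Nrm {ω : (H →L[ℂ] K) →ₗ[ℂ] ℂ} : ω ∈ Nrm H K ↔ ∃ r, NRep ω r := Iff.rfl

/-- Vector functional. -/
def vf (x : H) (y : K) : (H →L[ℂ] K) →ₗ[ℂ] ℂ where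
  toFun T := ⟪y, T x⟫
  map_add' _ _ := by simp [inner_add_right]
  map_smul' _ _ := by simp [inner_smul_right]

@[simp] lemma vf_apply (x : H) (y : K) (T : H →L[ℂ] K) : vf x y T = ⟪y, T x⟫ := rfl

lemma NRep.vf0 (x : H) (y : K) : NRep (vf x y) (‖x‖ ^ 2 + ‖y‖ ^ 2) :=
  NRep.of_countable (ι := Unit) (fun _ => x) (fun _ => y)
    (by simpa using hasSum_fintype (fun _ : Unit => ‖x‖ ^ 2 + ‖y‖ ^ 2))
    (fun T => by simpa using hasSum_fintype (fun _ : Unit => ⟪y, T x⟫))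

lemma vf_mem (x : H) (y : K) : vf x y ∈ Nrm H K := ⟨_, NRep.vf0 x y⟩

/-- continuity of normal functionals -/
lemma continuous_of_mem_Nrm {ω : (H →L[ℂ] K) →ₗ[ℂ] ℂ} (h : ω ∈ Nrm H K) :
    Continuous[sigmaWeak H K, _] ω := by
  obtain ⟨r, ξ, η, h, hT⟩ := h
  have e : (ω : (H →L[ℂ] K) → ℂ) = fun T => ∑' n, ⟪η n, T (ξ n)⟫ := by
    ext T; exact (hT T).tsum_eq.symm
  rw [e, continuous_iff_le_induced]
  refine iInf_le_of_le ξ (iInf_le_of_le η (iInf_le_of_le ?_ (iInf_le_of_le ?_ le_rfl)))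
  · exact h.summable.of_nonneg_of_le (fun _ => by positivity)
      (fun i => le_add_of_nonneg_right (by positivity))
  · exact h.summable.of_nonneg_of_le (fun _ => by positivity)
      (fun i => le_add_of_nonneg_left (by positivity))

lemma exists_mem_Nrm {ξ : ℕ → H} {η : ℕ → K} (h1 : Summable fun n => ‖ξ n‖ ^ 2)
    (h2 : Summable fun n => ‖η n‖ ^ 2) : ∃ ω ∈ Nrm H K, ∀ T, ω T = ∑' n, ⟪η n, T (ξ n)⟫ := by
  have h := h1.add h2
  refine ⟨⟨⟨fun T => ∑' n, ⟪η n, T (ξ n)⟫, fun S T => ?_⟩, fun c T => ?_⟩,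
    ⟨_, ξ, η, h.hasSum, fun T => (summable_pair h T).hasSum⟩, fun T => rfl⟩
  · simp only [add_apply, inner_add_right]
    exact (summable_pair h S).tsum_add (summable_pair h T)
  · simp only [smul_apply, inner_smul_right, RingHom.id_apply, smul_eq_mul]
    exact tsum_mul_left

lemma sigmaWeak_eq : sigmaWeak H K =
    TopologicalSpace.induced (fun (T : H →L[ℂ] K) (ω : Nrm H K) => (ω : (H →L[ℂ] K) →ₗ[ℂ] ℂ) T)
      Pi.topologicalSpace := by
  apply le_antisymm
  · rw [← continuous_iff_le_induced]
    refine @continuous_pi _ _ _ (sigmaWeak H K) _ _ (fun ω => ?_)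
    exact continuous_of_mem_Nrm ω.2
  · refine le_iInf fun ξ => le_iInf fun η => le_iInf fun h1 => le_iInf fun h2 => ?_
    obtain ⟨ω, hω, hT⟩ := exists_mem_Nrm h1 h2
    rw [← continuous_iff_le_induced]
    have := (continuous_apply (A := fun _ : Nrm H K => ℂ) (⟨ω, hω⟩ : Nrm H K))
    have h3 := @Continuous.comp _ _ _ (TopologicalSpace.induced
      (fun (T : H →L[ℂ] K) (ω : Nrm H K) => (ω : (H →L[ℂ] K) →ₗ[ℂ] ℂ) T)
      Pi.topologicalSpace) _ _ _ _ this continuous_induced_dom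
    simpa only [Function.comp_def, hT] using h3

/-- Separation. -/
lemma exists_sep (M : Submodule ℂ (H →L[ℂ] K)) (T : H →L[ℂ] K)
    (hT : T ∉ wkClosure (M : Set (H →L[ℂ] K))) :
    ∃ ω ∈ Nrm H K, (∀ S ∈ M, ω S = 0) ∧ ω T ≠ 0 := by
  classical
  unfold wkClosure at hT
  rw [sigmaWeak_eq, closure_induced, ← mem_compl_iff] at hT
  obtain ⟨I, u, hu, hsub⟩ := isOpen_pi_iff.1 isClosed_closure.isOpen_compl _ hT
  let F : (H →L[ℂ] K) →ₗ[ℂ] (I → ℂ) := LinearMap.pi fun i => (i.1 : (H →L[ℂ] K) →ₗ[ℂ] ℂ)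
  have hF : F T ∉ M.map F := by
    rintro ⟨m, hm, hmT⟩
    refine hsub (a := fun ω : Nrm H K => (ω : (H →L[ℂ] K) →ₗ[ℂ] ℂ) m) ?_
      (subset_closure ⟨m, hm, rfl⟩)
    intro ω hω
    have := congrFun hmT ⟨ω, hω⟩
    simp only [F, LinearMap.pi_apply] at this
    simp only [this]
    exact (hu ω hω).2
  obtain ⟨f, hf, hfM⟩ := Submodule.exists_le_ker_of_notMem hF
  refine ⟨f ∘ₗ F, ?_, fun S hS => hfM ⟨S, hS, rfl⟩, hf⟩
  have : f ∘ₗ F = ∑ i : I, f (Pi.single i 1) • (i.1 : (H →L[ℂ] K) →ₗ[ℂ] ℂ) := by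
    ext S
    simp only [LinearMap.comp_apply, LinearMap.sum_apply, LinearMap.smul_apply]
    rw [LinearMap.pi_apply_eq_sum_univ f]
    refine Finset.sum_congr rfl fun i _ => ?_
    simp only [smul_eq_mul, F, LinearMap.pi_apply]
    rw [mul_comm]
    congr 2
    ext j
    simp [Pi.single_apply, eq_comm]
  rw [this]
  exact Submodule.sum_mem _ fun i _ => Submodule.smul_mem _ _ i.1.2

lemma mem_Nrm_of_continuous (ω : (H →L[ℂ] K) →ₗ[ℂ] ℂ) (h : Continuous[sigmaWeak H K, _] ω) :
    ω ∈ Nrm H K := by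
  by_cases h0 : ω = 0
  · rw [h0]; exact Submodule.zero_mem _
  obtain ⟨T, hT⟩ : ∃ T, ω T ≠ 0 := by
    by_contra! hc
    exact h0 (LinearMap.ext hc)
  have hcl : IsClosed[sigmaWeak H K] (LinearMap.ker ω : Set (H →L[ℂ] K)) :=
    @IsClosed.preimage _ _ (sigmaWeak H K) _ _ h _ (isClosed_singleton (x := (0 : ℂ)))
  have : T ∉ wkClosure (LinearMap.ker ω : Set (H →L[ℂ] K)) := by
    unfold wkClosure
    rw [@IsClosed.closure_eq _ (sigmaWeak H K) _ hcl]
    exact hT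
  obtain ⟨ω', hω', hk, hne⟩ := exists_sep _ _ this
  have : ω = (ω T / ω' T) • ω' := by
    ext S
    have := hk (S - (ω S / ω T) • T) (by simp [hT])
    simp only [map_sub, map_smul, smul_eq_mul, sub_eq_zero] at this
    simp only [LinearMap.smul_apply, smul_eq_mul, this]
    field_simp
  rw [this]
  exact Submodule.smul_mem _ _ hω'

variable (H K) in
/-- The predual (projective) seminorm. -/
def pS : Seminorm ℂ (Nrm H K) :=
  Seminorm.ofSMulLE (fun ω => sInf {r | NRep (ω : (H →L[ℂ] K) →ₗ[ℂ] ℂ) r})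
    (le_antisymm (csInf_le ⟨0, fun _ h => h.nonneg⟩ NRep.zero)
      (Real.sInf_nonneg fun _ h => h.nonneg))
    (fun ω ω' => by
      refine le_of_forall_pos_le_add fun ε hε => ?_
      obtain ⟨r, hr, hr'⟩ := exists_lt_of_csInf_lt (mem_Nrm.1 ω.2)
        (lt_add_of_pos_right (sInf {r | NRep (ω : (H →L[ℂ] K) →ₗ[ℂ] ℂ) r}) (half_pos hε))
      obtain ⟨s, hs, hs'⟩ := exists_lt_of_csInf_lt (mem_Nrm.1 ω'.2)
        (lt_add_of_pos_right (sInf {r | NRep (ω' : (H →L[ℂ] K) →ₗ[ℂ] ℂ) r}) (half_pos hε))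
      have h : sInf {r | NRep ((ω + ω' : Nrm H K) : (H →L[ℂ] K) →ₗ[ℂ] ℂ) r} ≤ r + s :=
        csInf_le ⟨0, fun _ h => h.nonneg⟩ (NRep.add hr hs)
      linarith)
    (fun c ω => by
      refine le_of_forall_pos_le_add fun ε hε => ?_
      have h0 : 0 < ‖c‖ + 1 := by positivity
      obtain ⟨r, hr, hr'⟩ := exists_lt_of_csInf_lt (mem_Nrm.1 ω.2)
        (lt_add_of_pos_right (sInf {r | NRep (ω : (H →L[ℂ] K) →ₗ[ℂ] ℂ) r}) (div_pos hε h0))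
      have h : sInf {r | NRep ((c • ω : Nrm H K) : (H →L[ℂ] K) →ₗ[ℂ] ℂ) r} ≤ ‖c‖ * r :=
        csInf_le ⟨0, fun _ h => h.nonneg⟩ (NRep.smul hr c)
      have h1 : ‖c‖ * r ≤ ‖c‖ * (sInf {r | NRep (ω : (H →L[ℂ] K) →ₗ[ℂ] ℂ) r} + ε / (‖c‖ + 1)) := by
        gcongr
      have h2 : ‖c‖ * (ε / (‖c‖ + 1)) ≤ ε := by
        rw [mul_div_assoc', div_le_iff₀ h0]
        nlinarith [norm_nonneg c]
      linarith)

lemma pS_le {ω : Nrm H K} {r : ℝ} (h : NRep (ω : (H →L[ℂ] K) →ₗ[ℂ] ℂ) r) : pS H K ω ≤ r :=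
  csInf_le ⟨0, fun _ h => h.nonneg⟩ h

lemma exists_of_pS_lt {ω : Nrm H K} {s : ℝ} (h : pS H K ω < s) :
    ∃ r < s, NRep (ω : (H →L[ℂ] K) →ₗ[ℂ] ℂ) r := by
  obtain ⟨r, hr, hr'⟩ := exists_lt_of_csInf_lt (mem_Nrm.1 ω.2) h
  exact ⟨r, hr', hr⟩

lemma seminorm_dual {E : Type*} [AddCommGroup E] [Module ℂ E] (p : Seminorm ℂ E) (x : E) :
    ∃ g : E →ₗ[ℂ] ℂ, g x = p x ∧ ∀ y, ‖g y‖ ≤ p y := by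
  letI : SeminormedAddCommGroup E := p.toAddGroupSeminorm.toSeminormedAddCommGroup
  letI : NormedSpace ℂ E := ⟨fun c y => (map_smul_eq_mul p c y).le⟩
  obtain ⟨g, hg, hx⟩ := exists_dual_vector'' ℂ x
  refine ⟨g, hx, fun y => ?_⟩
  exact (g.le_of_opNorm_le hg y).trans (one_mul _).le

lemma pS_vf_le (x : H) (y : K) : pS H K ⟨vf x y, vf_mem x y⟩ ≤ 2 * (‖x‖ * ‖y‖) := by
  have hx : ((‖x‖ : ℂ) • ((‖x‖⁻¹ : ℝ) : ℂ) • x) = x := by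
    by_cases h : x = 0
    · simp [h]
    · rw [smul_smul, ← Complex.ofReal_mul, mul_inv_cancel₀ (norm_ne_zero_iff.2 h)]; simp
  have hy : ((‖y‖ : ℂ) • ((‖y‖⁻¹ : ℝ) : ℂ) • y) = y := by
    by_cases h : y = 0
    · simp [h]
    · rw [smul_smul, ← Complex.ofReal_mul, mul_inv_cancel₀ (norm_ne_zero_iff.2 h)]; simp
  have e : (⟨vf x y, vf_mem x y⟩ : Nrm H K) = ((‖x‖ * ‖y‖ : ℝ) : ℂ) •
      ⟨vf (((‖x‖⁻¹ : ℝ) : ℂ) • x) (((‖y‖⁻¹ : ℝ) : ℂ) • y), vf_mem _ _⟩ := by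
    ext T
    simp only [SetLike.mk_smul_mk, LinearMap.smul_apply, vf_apply]
    conv_lhs => rw [← hx, ← hy]
    rw [map_smul, inner_smul_left, inner_smul_right]
    simp only [Complex.conj_ofReal, smul_eq_mul, Complex.ofReal_mul]
    ring
  have hb : ∀ {E : Type _} [NormedAddCommGroup E] [InnerProductSpace ℂ E] (z : E),
      ‖((‖z‖⁻¹ : ℝ) : ℂ) • z‖ ^ 2 ≤ 1 := by
    intro E _ _ z
    rw [norm_smul, Complex.norm_real, norm_inv, norm_norm]
    by_cases h : z = 0
    · simp [h]
    · rw [inv_mul_cancel₀ (norm_ne_zero_iff.2 h)]; simp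
  have hby : ‖((‖y‖⁻¹ : ℝ) : ℂ) • y‖ ^ 2 ≤ 1 := by
    rw [norm_smul, Complex.norm_real, norm_inv, norm_norm]
    by_cases h : y = 0
    · simp [h]
    · rw [inv_mul_cancel₀ (norm_ne_zero_iff.2 h)]; simp
  rw [e, map_smul_eq_mul, Complex.norm_real, Real.norm_of_nonneg (by positivity)]
  have h1 := pS_le (ω := ⟨_, vf_mem _ _⟩)
    (NRep.vf0 (((‖x‖⁻¹ : ℝ) : ℂ) • x) (((‖y‖⁻¹ : ℝ) : ℂ) • y))
  have h2 := hb x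
  have h3 : pS H K ⟨vf (((‖x‖⁻¹ : ℝ) : ℂ) • x) (((‖y‖⁻¹ : ℝ) : ℂ) • y), vf_mem _ _⟩ ≤ 2 := by
    linarith
  have h4 : 0 ≤ ‖x‖ * ‖y‖ := by positivity
  nlinarith

/-- Riesz representation of a bounded sesquilinear form coming from a functional on normals. -/
lemma exists_op [CompleteSpace K] (g : Nrm H K →ₗ[ℂ] ℂ) (hg : ∀ ω, ‖g ω‖ ≤ pS H K ω) :
    ∃ T : H →L[ℂ] K, ‖T‖ ≤ 2 ∧ ∀ x y, g ⟨vf x y, vf_mem x y⟩ = ⟪y, T x⟫ := by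
  have hb : ∀ x y, ‖g ⟨vf x y, vf_mem x y⟩‖ ≤ 2 * (‖x‖ * ‖y‖) :=
    fun x y => (hg _).trans (pS_vf_le x y)
  have key : ∀ x : H, ∃ z : K, ∀ y, g ⟨vf x y, vf_mem x y⟩ = ⟪y, z⟫ := by
    intro x
    let l : K →ₗ[ℂ] ℂ :=
      { toFun := fun y => starRingEnd ℂ (g ⟨vf x y, vf_mem x y⟩)
        map_add' := fun y y' => by
          rw [← map_add, ← map_add]
          congr 2
          ext T
          simp [inner_add_left]
        map_smul' := fun c y => by
          have : (⟨vf x (c • y), vf_mem x (c • y)⟩ : Nrm H K)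
              = starRingEnd ℂ c • ⟨vf x y, vf_mem x y⟩ := by
            ext T
            simp [inner_smul_left, mul_comm]
          rw [this, map_smul]
          simp }
    let l' : StrongDual ℂ K := l.mkContinuous (2 * ‖x‖) (fun y => by
      simp only [l, LinearMap.coe_mk, AddHom.coe_mk, RCLike.norm_conj]
      linarith [hb x y])
    refine ⟨(InnerProductSpace.toDual ℂ K).symm l', fun y => ?_⟩
    rw [← inner_conj_symm, InnerProductSpace.toDual_symm_apply]
    simp [l', l]
  choose f hf using key
  let F : H →ₗ[ℂ] K :=
    { toFun := f
      map_add' := fun x x' => by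
        refine ext_inner_left ℂ fun y => ?_
        rw [inner_add_right, ← hf, ← hf, ← hf, ← map_add]
        congr 1
        ext T
        simp [inner_add_right]
      map_smul' := fun c x => by
        refine ext_inner_left ℂ fun y => ?_
        rw [RingHom.id_apply, inner_smul_right, ← hf, ← hf, ← smul_eq_mul, ← map_smul]
        congr 1
        ext T
        simp [inner_smul_right] }
  have hF : ∀ x, ‖F x‖ ≤ 2 * ‖x‖ := by
    intro x
    have h1 := hb x (f x)
    rw [hf, inner_self_eq_norm_sq_to_K] at h1
    have h2 : ‖f x‖ ^ 2 ≤ 2 * (‖x‖ * ‖f x‖) := by simpa using h1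
    have h3 : F x = f x := rfl
    rw [h3]
    by_contra! hc
    have : 0 < ‖f x‖ := lt_of_le_of_lt (by positivity) hc
    nlinarith
  exact ⟨F.mkContinuous 2 hF, F.mkContinuous_norm_le (by norm_num) hF, fun x y => hf x y⟩

/-- A normal functional has a representation controlled by its norm. -/
lemma exists_NRep_lt [CompleteSpace K] {ω : (H →L[ℂ] K) →ₗ[ℂ] ℂ} (hω : ω ∈ Nrm H K) {s : ℝ}
    (hs : ∀ T, ‖ω T‖ ≤ s * ‖T‖) (hs0 : 0 ≤ s) {s' : ℝ} (hs' : 2 * s < s') :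
    ∃ r < s', NRep ω r := by
  refine exists_of_pS_lt (ω := ⟨ω, hω⟩) (lt_of_le_of_lt ?_ hs')
  obtain ⟨g, hg, hgp⟩ := seminorm_dual (pS H K) ⟨ω, hω⟩
  obtain ⟨T, hT2, hT⟩ := exists_op g hgp
  have hgT : g ⟨ω, hω⟩ = ω T := by
    obtain ⟨r, ξ, η, h, hω'⟩ := hω
    have h1 := hω' T
    refine tendsto_nhds_unique ?_ h1
    have h2 : Tendsto (fun s : Finset ℕ => r - ∑ i ∈ s, (‖ξ i‖ ^ 2 + ‖η i‖ ^ 2)) atTop (𝓝 0) := by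
      have : Tendsto (fun s : Finset ℕ => ∑ i ∈ s, (‖ξ i‖ ^ 2 + ‖η i‖ ^ 2)) atTop (𝓝 r) := h
      simpa using (tendsto_const_nhds (x := r)).sub this
    rw [tendsto_iff_norm_sub_tendsto_zero]
    refine squeeze_zero (fun _ => norm_nonneg _) (fun t => ?_) h2
    have hω : ω ∈ Nrm H K := ⟨r, ξ, η, h, hω'⟩
    have e : ∑ i ∈ t, ⟪η i, T (ξ i)⟫ - g ⟨ω, hω⟩ =
        g (∑ i ∈ t, ⟨vf (ξ i) (η i), vf_mem _ _⟩ - ⟨ω, hω⟩) := by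
      simp [hT]
    show ‖∑ i ∈ t, ⟪η i, T (ξ i)⟫ - g ⟨ω, hω⟩‖ ≤ _
    rw [e, ← norm_neg, ← map_neg, neg_sub]
    refine (hgp _).trans (pS_le ?_)
    classical
    refine ⟨fun i => if i ∈ t then 0 else ξ i, fun i => if i ∈ t then 0 else η i, ?_, fun S => ?_⟩
    · have h3 := h.sub (hasSum_sum_of_ne_finset_zero
        (f := fun i => if i ∈ t then (‖ξ i‖ ^ 2 + ‖η i‖ ^ 2) else 0) (s := t)
        (fun i hi => by simp [hi]))
      rw [Finset.sum_congr rfl (g := fun i => ‖ξ i‖ ^ 2 + ‖η i‖ ^ 2)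
        (fun i hi => by simp [hi])] at h3
      refine hasSum_of_eq (fun i => ?_) h3
      by_cases hi : i ∈ t <;> simp [hi]
    · have h3 := (hω' S).sub (hasSum_sum_of_ne_finset_zero
        (f := fun i => if i ∈ t then ⟪η i, S (ξ i)⟫ else 0) (s := t)
        (fun i hi => by simp [hi]))
      rw [Finset.sum_congr rfl (g := fun i => ⟪η i, S (ξ i)⟫)
        (fun i hi => by simp [hi])] at h3
      have e2 : ((⟨ω, hω⟩ - ∑ i ∈ t, ⟨vf (ξ i) (η i), vf_mem _ _⟩ : Nrm H K) :
          (H →L[ℂ] K) →ₗ[ℂ] ℂ) S = ω S - ∑ i ∈ t, ⟪η i, S (ξ i)⟫ := by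
        simp
      rw [e2]
      refine hasSum_of_eq (fun i => ?_) h3
      by_cases hi : i ∈ t <;> simp [hi]
  have h1 : ‖g ⟨ω, hω⟩‖ ≤ s * ‖T‖ := by rw [hgT]; exact hs T
  rw [hg] at h1
  have h2 : pS H K ⟨ω, hω⟩ ≤ s * ‖T‖ := by
    simpa [abs_of_nonneg (apply_nonneg (pS H K) _)] using h1
  nlinarith

/-- Norm limits of (rapidly Cauchy sequences of) normal functionals are normal. -/
lemma exists_limit [CompleteSpace K] {ω : ℕ → (H →L[ℂ] K) →ₗ[ℂ] ℂ} (hω : ∀ k, ω k ∈ Nrm H K)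
    {c : ℝ} (hc : 0 ≤ c) (h : ∀ k T, ‖ω (k + 1) T - ω k T‖ ≤ c * (1 / 2) ^ k * ‖T‖) :
    ∃ Ω ∈ Nrm H K, ∀ T, Tendsto (fun k => ω k T) atTop (𝓝 (Ω T)) := by
  have h1 : ∀ k, ∃ r < (2 * c + 1) * (1 / 2) ^ k, NRep (ω (k + 1) - ω k) r := fun k =>
    exists_NRep_lt (Submodule.sub_mem _ (hω _) (hω _)) (fun T => h k T) (by positivity) (by
      have : (0 : ℝ) < (1 / 2) ^ k := by positivity
      nlinarith)
  choose r hr hrep using h1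
  have hsr : Summable r := Summable.of_nonneg_of_le (fun k => (hrep k).nonneg) (fun k => (hr k).le)
    (summable_geometric_two.mul_left _)
  have hs : ∀ T, Summable (fun k => (ω (k + 1) - ω k) T) := fun T =>
    Summable.of_norm_bounded (hsr.mul_left ‖T‖) (fun k => (hrep k).bound T)
  let Ω' : (H →L[ℂ] K) →ₗ[ℂ] ℂ :=
    { toFun := fun T => ∑' k, (ω (k + 1) - ω k) T
      map_add' := fun S T => by
        simp only [map_add]
        exact (hs S).tsum_add (hs T)
      map_smul' := fun a T => by
        simp only [map_smul, smul_eq_mul, RingHom.id_apply]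
        exact tsum_mul_left }
  refine ⟨ω 0 + Ω', Submodule.add_mem _ (hω 0)
    ⟨_, NRep.hasSum hrep hsr Ω' (fun T => (hs T).hasSum)⟩, fun T => ?_⟩
  have h2 := (hs T).hasSum.tendsto_sum_nat
  have h3 := (tendsto_const_nhds (x := ω 0 T)).add h2
  refine h3.congr fun n => ?_
  simp only [LinearMap.sub_apply]
  rw [Finset.sum_range_sub (fun k => ω k T)]
  ring

/-- `X ↦ A X B` as a linear map. -/
def cj (A : K →L[ℂ] K') (B : H' →L[ℂ] H) : (H →L[ℂ] K) →ₗ[ℂ] (H' →L[ℂ] K') where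
  toFun X := A ∘L X ∘L B
  map_add' _ _ := by ext; simp
  map_smul' _ _ := by ext; simp

@[simp] lemma cj_apply (A : K →L[ℂ] K') (B : H' →L[ℂ] H) (X : H →L[ℂ] K) (z : H') :
    cj A B X z = A (X (B z)) := rfl

lemma sq_norm_apply_le (A : H →L[ℂ] K) (x : H) : ‖A x‖ ^ 2 ≤ ‖A‖ ^ 2 * ‖x‖ ^ 2 := by
  rw [← mul_pow]
  exact pow_le_pow_left₀ (norm_nonneg _) (A.le_opNorm x) 2

lemma comp_cj_mem [CompleteSpace K] [CompleteSpace K'] {ω : (H' →L[ℂ] K') →ₗ[ℂ] ℂ}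
    (hω : ω ∈ Nrm H' K')
    (A : K →L[ℂ] K') (B : H' →L[ℂ] H) : ω ∘ₗ cj A B ∈ Nrm H K := by
  obtain ⟨r, ξ, η, h, hT⟩ := hω
  have h1 : Summable fun n => ‖ξ n‖ ^ 2 := h.summable.of_nonneg_of_le (fun _ => by positivity)
      (fun i => le_add_of_nonneg_right (by positivity))
  have h2 : Summable fun n => ‖η n‖ ^ 2 := h.summable.of_nonneg_of_le (fun _ => by positivity)
      (fun i => le_add_of_nonneg_left (by positivity))
  obtain ⟨ω', hω', he⟩ := exists_mem_Nrm (ξ := fun n => B (ξ n))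
    (η := fun n => (ContinuousLinearMap.adjoint A) (η n))
    ((h1.mul_left (‖B‖ ^ 2)).of_nonneg_of_le (fun _ => by positivity)
      (fun i => sq_norm_apply_le _ _))
    ((h2.mul_left (‖ContinuousLinearMap.adjoint A‖ ^ 2)).of_nonneg_of_le (fun _ => by positivity)
      (fun i => sq_norm_apply_le _ _))
  have : ω ∘ₗ cj A B = ω' := by
    ext T
    rw [he, LinearMap.comp_apply, ← (hT _).tsum_eq]
    simp [ContinuousLinearMap.adjoint_inner_left]
  rwa [this]

lemma cb_fin {φ : (H →L[ℂ] K) →ₗ[ℂ] (H →L[ℂ] K)} {C : ℝ}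
    (hcb : ∀ (n : ℕ) (M : Matrix (Fin n) (Fin n) (H →L[ℂ] K)),
      blockNorm (M.map φ) ≤ C * blockNorm M) (hC : 0 ≤ C)
    {n : ℕ} (M : Matrix (Fin n) (Fin n) (H →L[ℂ] K)) {b : ℝ} (hb : 0 ≤ b)
    (hM : ∀ v : Fin n → H, ∑ i, ‖∑ j, M i j (v j)‖ ^ 2 ≤ b ^ 2 * ∑ j, ‖v j‖ ^ 2) (v : Fin n → H) :
    ∑ i, ‖∑ j, φ (M i j) (v j)‖ ^ 2 ≤ (C * b) ^ 2 * ∑ j, ‖v j‖ ^ 2 := by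
  have h1 : blockNorm M ≤ b := by
    refine csSup_le ⟨_, 0, by simp, rfl⟩ ?_
    rintro r ⟨w, hw, rfl⟩
    rw [Real.sqrt_le_left hb]
    refine (hM w).trans ?_
    nlinarith [sq_nonneg b]
  have h2 : ∀ w : Fin n → H, ∑ j, ‖w j‖ ^ 2 ≤ 1 →
      ∑ i, ‖∑ j, φ (M i j) (w j)‖ ^ 2 ≤ (C * b) ^ 2 := by
    intro w hw
    have hbdd : BddAbove { r | ∃ v : Fin n → H, (∑ j, ‖v j‖ ^ 2) ≤ 1 ∧
        r = Real.sqrt (∑ i, ‖∑ j, (M.map φ) i j (v j)‖ ^ 2) } := by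
      refine ⟨Real.sqrt (∑ i, (∑ j, ‖(M.map φ) i j‖) ^ 2), ?_⟩
      rintro r ⟨u, hu, rfl⟩
      refine Real.sqrt_le_sqrt (Finset.sum_le_sum fun i _ => ?_)
      refine pow_le_pow_left₀ (norm_nonneg _) ((norm_sum_le _ _).trans
        (Finset.sum_le_sum fun j _ => ?_)) 2
      have hj : ‖u j‖ ^ 2 ≤ 1 := (Finset.single_le_sum (f := fun j => ‖u j‖ ^ 2)
        (fun _ _ => by positivity) (Finset.mem_univ j)).trans hu
      have hj' : ‖u j‖ ≤ 1 := by nlinarith [norm_nonneg (u j)]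
      exact ((M.map φ) i j).le_opNorm_of_le hj' |>.trans (mul_one _).le
    have h3 : Real.sqrt (∑ i, ‖∑ j, (M.map φ) i j (w j)‖ ^ 2) ≤ blockNorm (M.map φ) :=
      le_csSup hbdd ⟨w, hw, rfl⟩
    have h4 := h3.trans ((hcb n M).trans (mul_le_mul_of_nonneg_left h1 hC))
    rw [Real.sqrt_le_left (by positivity)] at h4
    simpa using h4
  set s := ∑ j, ‖v j‖ ^ 2 with hs
  have hs0 : 0 ≤ s := Finset.sum_nonneg fun _ _ => by positivity
  rcases hs0.eq_or_lt with h0 | h0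
  · have hv : v = 0 := by
      ext j
      have := (Finset.sum_eq_zero_iff_of_nonneg (fun _ _ => by positivity)).1 h0.symm j
        (Finset.mem_univ j)
      simpa using this
    simp [hv, ← h0]
  · have hq : Real.sqrt s ^ 2 = s := Real.sq_sqrt hs0
    have hqp : 0 < Real.sqrt s := Real.sqrt_pos.2 h0
    have hn : ‖(((Real.sqrt s)⁻¹ : ℝ) : ℂ)‖ ^ 2 = s⁻¹ := by
      rw [Complex.norm_real, norm_inv, Real.norm_of_nonneg hqp.le, inv_pow, hq]
    have h3 := h2 (fun j => (((Real.sqrt s)⁻¹ : ℝ) : ℂ) • v j) (by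
      simp only [norm_smul, mul_pow, hn]
      rw [← Finset.mul_sum, ← hs, inv_mul_cancel₀ h0.ne'])
    simp only [map_smul, ← Finset.smul_sum, norm_smul, mul_pow, hn] at h3
    rw [← Finset.mul_sum, inv_mul_le_iff₀ h0] at h3
    linarith [h3, mul_pow C b 2, mul_comm s ((C * b) ^ 2),
      congrArg (s * ·) (mul_pow C b 2)]

lemma cb_sq {φ : (H →L[ℂ] K) →ₗ[ℂ] (H →L[ℂ] K)} {C : ℝ}
    (hcb : ∀ (n : ℕ) (M : Matrix (Fin n) (Fin n) (H →L[ℂ] K)),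
      blockNorm (M.map φ) ≤ C * blockNorm M) (hC : 0 ≤ C)
    {ι : Type*} [Fintype ι] (M : ι → ι → (H →L[ℂ] K)) {b : ℝ} (hb : 0 ≤ b)
    (hM : ∀ v : ι → H, ∑ i, ‖∑ j, M i j (v j)‖ ^ 2 ≤ b ^ 2 * ∑ j, ‖v j‖ ^ 2) (v : ι → H) :
    ∑ i, ‖∑ j, φ (M i j) (v j)‖ ^ 2 ≤ (C * b) ^ 2 * ∑ j, ‖v j‖ ^ 2 := by
  let e := Fintype.equivFin ι
  have h := cb_fin hcb hC (fun i j => M (e.symm i) (e.symm j)) hb (fun w => by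
    have := hM (w ∘ e)
    rw [← e.symm.sum_comp, ← e.symm.sum_comp (fun j => ‖(w ∘ e) j‖ ^ 2)] at this
    simp only [← e.symm.sum_comp (fun j => M _ j ((w ∘ e) j))] at this
    simpa using this) (v ∘ e.symm)
  rw [← e.symm.sum_comp, ← e.symm.sum_comp (fun j => ‖v j‖ ^ 2)]
  simp only [← e.symm.sum_comp (fun j => φ (M _ j) (v j))]
  exact h

lemma cb_rect {φ : (H →L[ℂ] K) →ₗ[ℂ] (H →L[ℂ] K)} {C : ℝ}
    (hcb : ∀ (n : ℕ) (M : Matrix (Fin n) (Fin n) (H →L[ℂ] K)),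
      blockNorm (M.map φ) ≤ C * blockNorm M) (hC : 0 ≤ C)
    {ι κ : Type*} [Fintype ι] [Fintype κ] (M : κ → ι → (H →L[ℂ] K)) {b : ℝ} (hb : 0 ≤ b)
    (hM : ∀ v : ι → H, ∑ i, ‖∑ j, M i j (v j)‖ ^ 2 ≤ b ^ 2 * ∑ j, ‖v j‖ ^ 2) (v : ι → H) :
    ∑ i, ‖∑ j, φ (M i j) (v j)‖ ^ 2 ≤ (C * b) ^ 2 * ∑ j, ‖v j‖ ^ 2 := by
  let N : κ ⊕ ι → κ ⊕ ι → (H →L[ℂ] K) := fun i j =>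
    Sum.elim (fun i => Sum.elim (fun _ => 0) (fun j => M i j) j) (fun _ => 0) i
  have h := cb_sq hcb hC N hb (fun w => by
    have := hM (w ∘ Sum.inr)
    simp only [N, Fintype.sum_sum_type]
    simp only [Sum.elim_inl, Sum.elim_inr, zero_apply, Finset.sum_const_zero, zero_add, add_zero,
      norm_zero, ne_eq, OfNat.ofNat_ne_zero, not_false_eq_true, zero_pow]
    refine this.trans (mul_le_mul_of_nonneg_left ?_ (sq_nonneg b))
    exact le_add_of_nonneg_left (Finset.sum_nonneg fun _ _ => by positivity))
    (Sum.elim 0 v)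
  simp only [N, Fintype.sum_sum_type] at h
  simpa only [Sum.elim_inl, Sum.elim_inr, zero_apply, Finset.sum_const_zero, zero_add, add_zero,
      norm_zero, ne_eq, OfNat.ofNat_ne_zero, not_false_eq_true, zero_pow, map_zero, 
      Pi.zero_apply] using h

/-- A family of isometries with orthogonal ranges. -/
structure IOrth {ι : Type*} (L : ι → H →L[ℂ] K) : Prop where
  same : ∀ i x y, ⟪L i x, L i y⟫ = ⟪x, y⟫
  ne : ∀ i j x y, i ≠ j → ⟪L i x, L j y⟫ = 0

/-- Such a family whose ranges span everything. -/
structure ISys {ι : Type*} [CompleteSpace H] [CompleteSpace K] (L : ι → H →L[ℂ] K) : Prop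
    extends IOrth L where
  total : ∀ z, Tendsto (fun F : Finset ι => ∑ i ∈ F, L i (ContinuousLinearMap.adjoint (L i) z))
    atTop (𝓝 z)

/-- Partial sum projections. -/
def pj {ι : Type*} [CompleteSpace H] [CompleteSpace K] (L : ι → H →L[ℂ] K) (F : Finset ι) :
    K →L[ℂ] K := ∑ i ∈ F, L i ∘L (ContinuousLinearMap.adjoint (L i))

section
variable {ι : Type*} [CompleteSpace H] [CompleteSpace K] {L : ι → H →L[ℂ] K}

lemma pj_apply (F : Finset ι) (z : K) :
    pj L F z = ∑ i ∈ F, L i (ContinuousLinearMap.adjoint (L i) z) := by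
  simp [pj]

lemma IOrth.adj_same (h : IOrth L) (i : ι) (x : H) :
    ContinuousLinearMap.adjoint (L i) (L i x) = x := by
  refine ext_inner_left ℂ fun v => ?_
  rw [ContinuousLinearMap.adjoint_inner_right, h.same]

lemma IOrth.adj_ne (h : IOrth L) {i j : ι} (hij : i ≠ j) (x : H) :
    ContinuousLinearMap.adjoint (L i) (L j x) = 0 := by
  refine ext_inner_left ℂ fun v => ?_
  rw [ContinuousLinearMap.adjoint_inner_right, h.ne _ _ _ _ hij, inner_zero_right]

lemma IOrth.adj_sum (h : IOrth L) {F : Finset ι} {i : ι} (hi : i ∈ F) (v : ι → H) :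
    ContinuousLinearMap.adjoint (L i) (∑ j ∈ F, L j (v j)) = v i := by
  rw [map_sum, Finset.sum_eq_single i, h.adj_same]
  · intro j _ hj
    exact h.adj_ne hj.symm _
  · intro h'
    exact absurd hi h'

lemma IOrth.norm_sum (h : IOrth L) (F : Finset ι) (v : ι → H) :
    ‖∑ i ∈ F, L i (v i)‖ ^ 2 = ∑ i ∈ F, ‖v i‖ ^ 2 := by
  have h1 : (⟪∑ i ∈ F, L i (v i), ∑ i ∈ F, L i (v i)⟫ : ℂ) = ∑ i ∈ F, ⟪v i, v i⟫ := by
    rw [sum_inner]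
    refine Finset.sum_congr rfl fun i hi => ?_
    rw [← ContinuousLinearMap.adjoint_inner_right, h.adj_sum hi]
  have h2 := congrArg Complex.re h1
  rw [Complex.re_sum] at h2
  simpa [inner_self_eq_norm_sq_to_K, ← Complex.ofReal_pow] using h2

lemma pj_symm (F : Finset ι) (x y : K) : ⟪pj L F x, y⟫ = ⟪x, pj L F y⟫ := by
  rw [pj_apply, pj_apply, sum_inner, inner_sum]
  refine Finset.sum_congr rfl fun i _ => ?_
  rw [← ContinuousLinearMap.adjoint_inner_right, ContinuousLinearMap.adjoint_inner_left]

lemma IOrth.norm_pj_sq (h : IOrth L) (F : Finset ι) (z : K) :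
    ‖pj L F z‖ ^ 2 = ∑ i ∈ F, ‖ContinuousLinearMap.adjoint (L i) z‖ ^ 2 := by
  rw [pj_apply, h.norm_sum]

lemma IOrth.adj_pj (h : IOrth L) {F : Finset ι} {i : ι} (hi : i ∈ F) (z : K) :
    ContinuousLinearMap.adjoint (L i) (pj L F z) = ContinuousLinearMap.adjoint (L i) z := by
  rw [pj_apply, h.adj_sum hi (fun j => ContinuousLinearMap.adjoint (L j) z)]

lemma IOrth.adj_pj_not (h : IOrth L) {F : Finset ι} {i : ι} (hi : i ∉ F) (z : K) :
    ContinuousLinearMap.adjoint (L i) (pj L F z) = 0 := by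
  rw [pj_apply, map_sum]
  refine Finset.sum_eq_zero fun j hj => h.adj_ne ?_ _
  rintro rfl
  exact hi hj

lemma IOrth.pj_mem (h : IOrth L) {F : Finset ι} {i : ι} (hi : i ∈ F) (x : H) :
    pj L F (L i x) = L i x := by
  rw [pj_apply, Finset.sum_eq_single i, h.adj_same]
  · intro j _ hj
    rw [h.adj_ne hj, map_zero]
  · intro h'
    exact absurd hi h'

lemma IOrth.pj_not_mem (h : IOrth L) {F : Finset ι} {i : ι} (hi : i ∉ F) (x : H) :
    pj L F (L i x) = 0 := by
  rw [pj_apply]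
  refine Finset.sum_eq_zero fun j hj => ?_
  rw [h.adj_ne, map_zero]
  rintro rfl
  exact hi hj

lemma IOrth.pj_pj (h : IOrth L) (F : Finset ι) (z : K) : pj L F (pj L F z) = pj L F z := by
  rw [pj_apply F (pj L F z), pj_apply F z]
  exact Finset.sum_congr rfl fun i hi => by rw [← pj_apply, h.adj_pj hi]

lemma IOrth.norm_pj_le (h : IOrth L) (F : Finset ι) (z : K) : ‖pj L F z‖ ≤ ‖z‖ := by
  have h1 : (⟪pj L F z, pj L F z⟫ : ℂ) = ⟪z, pj L F z⟫ := by rw [pj_symm, h.pj_pj]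
  have h2 : ‖pj L F z‖ ^ 2 ≤ ‖z‖ * ‖pj L F z‖ := by
    have h3 := norm_inner_le_norm (𝕜 := ℂ) z (pj L F z)
    rw [← h1, inner_self_eq_norm_sq_to_K] at h3
    simpa using h3
  by_contra hlt
  push Not at hlt
  nlinarith [norm_nonneg z]

lemma IOrth.bessel (h : IOrth L) (F : Finset ι) (z : K) :
    ∑ i ∈ F, ‖ContinuousLinearMap.adjoint (L i) z‖ ^ 2 ≤ ‖z‖ ^ 2 := by
  rw [← h.norm_pj_sq]
  exact pow_le_pow_left₀ (norm_nonneg _) (h.norm_pj_le F z) 2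

lemma ISys.tendsto_pj (h : ISys L) (z : K) : Tendsto (fun F => pj L F z) atTop (𝓝 z) := by
  simpa only [pj_apply] using h.total z

lemma ISys.exists_fin (h : ISys L) {ξ : ℕ → K} (hξ : Summable fun n => ‖ξ n‖ ^ 2) :
    ∃ F : ℕ → Finset ι, Monotone F ∧ ∀ k, Summable (fun n => ‖ξ n - pj L (F k) (ξ n)‖ ^ 2) ∧
      ∑' n, ‖ξ n - pj L (F k) (ξ n)‖ ^ 2 ≤ (1 / 4) ^ k := by
  classical
  have hb : ∀ F n, ‖ξ n - pj L F (ξ n)‖ ^ 2 ≤ 4 * ‖ξ n‖ ^ 2 := by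
    intro F n
    have h1 := norm_sub_le (ξ n) (pj L F (ξ n))
    have h2 := h.norm_pj_le F (ξ n)
    nlinarith [norm_nonneg (ξ n - pj L F (ξ n)), norm_nonneg (ξ n)]
  have ht : Tendsto (fun F => ∑' n, ‖ξ n - pj L F (ξ n)‖ ^ 2) atTop (𝓝 (∑' _ : ℕ, (0 : ℝ))) := by
    refine tendsto_tsum_of_dominated_convergence (hξ.mul_left 4) (fun n => ?_)
      (Eventually.of_forall fun F n => ?_)
    · have := ((h.tendsto_pj (ξ n)).const_sub (ξ n)).norm.pow 2
      simpa using this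
    · rw [Real.norm_of_nonneg (by positivity)]
      exact hb F n
  rw [tsum_zero] at ht
  have h0 : ∀ k : ℕ, ∃ F0 : Finset ι, ∀ F, F0 ≤ F → ∑' n, ‖ξ n - pj L F (ξ n)‖ ^ 2 ≤ (1 / 4) ^ k := by
    intro k
    have := ht.eventually (ge_mem_nhds (show (0 : ℝ) < (1 / 4) ^ k by positivity))
    exact eventually_atTop.1 this
  choose F0 hF0 using h0
  refine ⟨fun k => (Finset.range (k + 1)).biUnion F0, ?_, fun k => ⟨?_, hF0 k _ ?_⟩⟩
  · intro a b hab
    exact Finset.biUnion_subset_biUnion_of_subset_left _ (Finset.range_mono (by omega))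
  · exact (hξ.mul_left 4).of_nonneg_of_le (fun _ => by positivity) (hb _)
  · exact Finset.subset_biUnion_of_mem F0 (Finset.mem_range.2 (Nat.lt_succ_self k))

end

section
variable {ι κ : Type*} [CompleteSpace H] [CompleteSpace K] [CompleteSpace H'] [CompleteSpace K']
  {L : ι → H →L[ℂ] H'} {M : κ → K →L[ℂ] K'}

lemma approx (hL : ISys L) (hM : ISys M) {ω : (H' →L[ℂ] K') →ₗ[ℂ] ℂ} (hω : ω ∈ Nrm H' K') :
    ∃ (F : ℕ → Finset ι) (G : ℕ → Finset κ) (c : ℝ), Monotone F ∧ Monotone G ∧ 0 ≤ c ∧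
      ∀ k S, ‖ω S - ω (cj (pj M (G k)) (pj L (F k)) S)‖ ≤ c * (1 / 2) ^ k * ‖S‖ := by
  obtain ⟨r, ξ, η, h, hT⟩ := hω
  have h1 : Summable fun n => ‖ξ n‖ ^ 2 := h.summable.of_nonneg_of_le (fun _ => by positivity)
      (fun i => le_add_of_nonneg_right (by positivity))
  have h2 : Summable fun n => ‖η n‖ ^ 2 := h.summable.of_nonneg_of_le (fun _ => by positivity)
      (fun i => le_add_of_nonneg_left (by positivity))
  obtain ⟨F, hF, hF'⟩ := hL.exists_fin h1
  obtain ⟨G, hG, hG'⟩ := hM.exists_fin h2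
  have hr : 0 ≤ r := h.nonneg fun _ => by positivity
  refine ⟨F, G, r + 2, hF, hG, by positivity, fun k S => ?_⟩
  have hs := (hT S).sub (hT (cj (pj M (G k)) (pj L (F k)) S))
  set a : ℕ → ℝ := fun n => ‖ξ n - pj L (F k) (ξ n)‖ ^ 2 with ha
  set b : ℕ → ℝ := fun n => ‖η n - pj M (G k) (η n)‖ ^ 2 with hb
  have hpos : (0 : ℝ) < 2 ^ k := by positivity
  have hbd : HasSum (fun n => ‖S‖ * ((1 / 2) ^ k * (‖ξ n‖ ^ 2 + ‖η n‖ ^ 2) + (2 ^ k * a n + 2 ^ k * b n)))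
      (‖S‖ * ((1 / 2) ^ k * r + (2 ^ k * ∑' n, a n + 2 ^ k * ∑' n, b n))) :=
    ((h.mul_left _).add (((hF' k).1.hasSum.mul_left _).add ((hG' k).1.hasSum.mul_left _))).mul_left _
  rw [← hs.tsum_eq]
  refine (tsum_of_norm_bounded hbd fun n => ?_).trans ?_
  · have e : ⟪η n, S (ξ n)⟫ - ⟪η n, cj (pj M (G k)) (pj L (F k)) S (ξ n)⟫ =
        ⟪η n - pj M (G k) (η n), S (ξ n)⟫ + ⟪pj M (G k) (η n), S (ξ n - pj L (F k) (ξ n))⟫ := by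
      rw [cj_apply, ← pj_symm, inner_sub_left, map_sub, inner_sub_right]
      ring
    rw [e]
    have am : ∀ u v : ℝ, u * v ≤ 2 ^ k * u ^ 2 + (1 / 2) ^ k * v ^ 2 := by
      intro u v
      have e1 : (1 / 2 : ℝ) ^ k = (2 ^ k)⁻¹ := by simp
      have : 2 ^ k * u ^ 2 + (2 ^ k)⁻¹ * v ^ 2 - u * v =
          (2 ^ k)⁻¹ * (((2 ^ k * u) - v / 2) ^ 2 + 3 / 4 * v ^ 2) := by
        field_simp
        ring
      have : 0 ≤ (2 ^ k : ℝ)⁻¹ * (((2 ^ k * u) - v / 2) ^ 2 + 3 / 4 * v ^ 2) := by positivity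
      rw [e1]
      linarith
    have b1 : ‖(⟪η n - pj M (G k) (η n), S (ξ n)⟫ : ℂ)‖ ≤
        ‖S‖ * (‖η n - pj M (G k) (η n)‖ * ‖ξ n‖) := by
      refine (norm_inner_le_norm _ _).trans ?_
      have := mul_le_mul_of_nonneg_left (S.le_opNorm (ξ n)) (norm_nonneg (η n - pj M (G k) (η n)))
      linarith
    have b2 : ‖(⟪pj M (G k) (η n), S (ξ n - pj L (F k) (ξ n))⟫ : ℂ)‖ ≤
        ‖S‖ * (‖ξ n - pj L (F k) (ξ n)‖ * ‖η n‖) := by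
      refine (norm_inner_le_norm _ _).trans ?_
      refine (mul_le_mul (hM.norm_pj_le _ _) (S.le_opNorm _) (norm_nonneg _) (norm_nonneg _)).trans ?_
      exact le_of_eq (by ring)
    refine (norm_add_le _ _).trans ((add_le_add b1 b2).trans ?_)
    rw [← mul_add]
    refine mul_le_mul_of_nonneg_left ?_ (norm_nonneg S)
    have := am ‖η n - pj M (G k) (η n)‖ ‖ξ n‖
    have := am ‖ξ n - pj L (F k) (ξ n)‖ ‖η n‖
    simp only [ha, hb]
    linarith
  · have e2 : (2 : ℝ) ^ k * (1 / 4) ^ k = (1 / 2) ^ k := by rw [← mul_pow]; norm_num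
    have b1 := mul_le_mul_of_nonneg_left (hF' k).2 hpos.le
    have b2 := mul_le_mul_of_nonneg_left (hG' k).2 hpos.le
    rw [e2] at b1 b2
    have : (1 / 2) ^ k * r + (2 ^ k * ∑' n, a n + 2 ^ k * ∑' n, b n) ≤ (r + 2) * (1 / 2) ^ k := by
      linarith
    calc _ ≤ ‖S‖ * ((r + 2) * (1 / 2) ^ k) := mul_le_mul_of_nonneg_left this (norm_nonneg S)
      _ = _ := by ring

/-- The amplification of `φ` to finitely many blocks. -/
def amp (φ : (H →L[ℂ] K) →ₗ[ℂ] (H →L[ℂ] K)) (L : ι → H →L[ℂ] H') (M : κ → K →L[ℂ] K')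
    (F : Finset ι) (G : Finset κ) : (H' →L[ℂ] K') →ₗ[ℂ] (H' →L[ℂ] K') :=
  ∑ j ∈ G, ∑ i ∈ F, cj (M j) (ContinuousLinearMap.adjoint (L i)) ∘ₗ φ ∘ₗ
    cj (ContinuousLinearMap.adjoint (M j)) (L i)

lemma amp_apply (φ : (H →L[ℂ] K) →ₗ[ℂ] (H →L[ℂ] K)) (F : Finset ι) (G : Finset κ)
    (S : H' →L[ℂ] K') (z : H') :
    amp φ L M F G S z = ∑ j ∈ G, M j (∑ i ∈ F,
      φ (cj (ContinuousLinearMap.adjoint (M j)) (L i) S) (ContinuousLinearMap.adjoint (L i) z)) := by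
  simp [amp, LinearMap.sum_apply]

lemma comp_amp_mem {φ : (H →L[ℂ] K) →ₗ[ℂ] (H →L[ℂ] K)} (hφ : WkContinuous φ)
    (F : Finset ι) (G : Finset κ) {ω : (H' →L[ℂ] K') →ₗ[ℂ] ℂ} (hω : ω ∈ Nrm H' K') :
    ω ∘ₗ amp φ L M F G ∈ Nrm H' K' := by
  have : ω ∘ₗ amp φ L M F G = ∑ j ∈ G, ∑ i ∈ F,
      ((ω ∘ₗ cj (M j) (ContinuousLinearMap.adjoint (L i))) ∘ₗ φ) ∘ₗ
        cj (ContinuousLinearMap.adjoint (M j)) (L i) := by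
    ext S
    simp [amp, LinearMap.sum_apply]
  rw [this]
  refine Submodule.sum_mem _ fun j _ => Submodule.sum_mem _ fun i _ => comp_cj_mem ?_ _ _
  refine mem_Nrm_of_continuous _ ?_
  have hc := continuous_of_mem_Nrm (comp_cj_mem hω (M j) (ContinuousLinearMap.adjoint (L i)))
  exact @Continuous.comp _ _ _ (sigmaWeak H K) (sigmaWeak H K) _ φ
    (ω ∘ₗ cj (M j) (ContinuousLinearMap.adjoint (L i))) hc hφ

lemma norm_amp_le (hL : ISys L) (hM : ISys M) {φ : (H →L[ℂ] K) →ₗ[ℂ] (H →L[ℂ] K)} {C : ℝ}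
    (hcb : ∀ (n : ℕ) (M : Matrix (Fin n) (Fin n) (H →L[ℂ] K)),
      blockNorm (M.map φ) ≤ C * blockNorm M) (hC : 0 ≤ C)
    (F : Finset ι) (G : Finset κ) (S : H' →L[ℂ] K') : ‖amp φ L M F G S‖ ≤ C * ‖S‖ := by
  refine ContinuousLinearMap.opNorm_le_bound _ (by positivity) fun z => ?_
  refine le_of_sq_le_sq ?_ (by positivity)
  rw [amp_apply, hM.norm_sum G (fun j => ∑ i ∈ F,
    φ (cj (ContinuousLinearMap.adjoint (M j)) (L i) S) (ContinuousLinearMap.adjoint (L i) z))]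
  have key := cb_rect (ι := F) (κ := G) hcb hC
    (fun j i => cj (ContinuousLinearMap.adjoint (M j)) (L i) S) (norm_nonneg S) ?_
    (fun i => ContinuousLinearMap.adjoint (L i) z)
  · rw [← Finset.sum_coe_sort G]
    simp only [← Finset.sum_coe_sort F]
    refine key.trans ?_
    rw [mul_pow (C * ‖S‖) ‖z‖]
    refine mul_le_mul_of_nonneg_left ?_ (by positivity)
    have := hL.bessel F z
    rwa [← Finset.sum_coe_sort F] at this
  · intro v
    classical
    let w : ι → H := fun i => if h : i ∈ F then v ⟨i, h⟩ else 0
    have hw : ∀ i : F, v i = w i := fun i => by simp [w]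
    have e1 : ∑ i : F, ‖v i‖ ^ 2 = ∑ i ∈ F, ‖w i‖ ^ 2 := by
      rw [← Finset.sum_coe_sort F]; simp only [hw]
    have e2 : ∀ j : G, ∑ i : F, cj (ContinuousLinearMap.adjoint (M j)) (L i) S (v i) =
        ContinuousLinearMap.adjoint (M j) (S (∑ i ∈ F, L i (w i))) := by
      intro j
      rw [← Finset.sum_coe_sort F, map_sum, map_sum]
      simp only [hw, cj_apply]
    simp only [e2]
    rw [Finset.sum_coe_sort G (fun j => ‖ContinuousLinearMap.adjoint (M j) (S (∑ i ∈ F, L i (w i)))‖ ^ 2), e1,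
      ← hL.norm_sum]
    exact (hM.bessel G _).trans (sq_norm_apply_le _ _)

lemma compress_amp (hL : ISys L) (hM : ISys M) (φ : (H →L[ℂ] K) →ₗ[ℂ] (H →L[ℂ] K))
    {F F' : Finset ι} {G G' : Finset κ} (hF : F ⊆ F') (hG : G ⊆ G') (S : H' →L[ℂ] K') :
    cj (pj M G) (pj L F) (amp φ L M F' G' S) = amp φ L M F G S := by
  ext z
  rw [cj_apply, amp_apply, amp_apply, map_sum]
  rw [← Finset.sum_subset hG]
  · refine Finset.sum_congr rfl fun j hj => ?_
    rw [hM.pj_mem hj, ← Finset.sum_subset hF]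
    · congr 1
      exact Finset.sum_congr rfl fun i hi => by rw [hL.adj_pj hi]
    · intro i _ hi
      rw [hL.adj_pj_not hi, map_zero]
  · intro j _ hj
    rw [hM.pj_not_mem hj]

lemma amp_eq {φ : (H →L[ℂ] K) →ₗ[ℂ] (H →L[ℂ] K)} {W W' : H' →L[ℂ] K'}
    (h : ∀ i j, cj (ContinuousLinearMap.adjoint (M j)) (L i) W' =
      φ (cj (ContinuousLinearMap.adjoint (M j)) (L i) W)) (F : Finset ι) (G : Finset κ) :
    amp φ L M F G W = cj (pj M G) (pj L F) W' := by
  ext z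
  rw [cj_apply, amp_apply, pj_apply]
  refine Finset.sum_congr rfl fun j _ => ?_
  congr 1
  rw [pj_apply, map_sum, map_sum]
  exact Finset.sum_congr rfl fun i _ => by rw [← h, cj_apply]

lemma exists_amp (hL : ISys L) (hM : ISys M) {φ : (H →L[ℂ] K) →ₗ[ℂ] (H →L[ℂ] K)}
    (hφ : WkContinuous φ) (hcb : CompletelyBounded φ)
    {ω : (H' →L[ℂ] K') →ₗ[ℂ] ℂ} (hω : ω ∈ Nrm H' K') :
    ∃ Ω ∈ Nrm H' K', ∀ W W' : H' →L[ℂ] K',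
      (∀ i j, cj (ContinuousLinearMap.adjoint (M j)) (L i) W' =
        φ (cj (ContinuousLinearMap.adjoint (M j)) (L i) W)) → Ω W = ω W' := by
  obtain ⟨C, hC, hcb⟩ := hcb
  obtain ⟨F, G, c, hF, hG, hc, happ⟩ := approx hL hM hω
  obtain ⟨Ω, hΩ, hlim⟩ := exists_limit (ω := fun k => ω ∘ₗ amp φ L M (F k) (G k)) (c := c * C)
    (fun k => comp_amp_mem hφ _ _ hω) (by positivity) (fun k S => by
      have := happ k (amp φ L M (F (k + 1)) (G (k + 1)) S)
      rw [compress_amp hL hM φ (hF (Nat.le_succ k)) (hG (Nat.le_succ k))] at this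
      refine this.trans ?_
      calc _ ≤ c * (1 / 2) ^ k * (C * ‖S‖) :=
            mul_le_mul_of_nonneg_left (norm_amp_le hL hM hcb hC _ _ S) (by positivity)
        _ = _ := by ring)
  refine ⟨Ω, hΩ, fun W W' h => tendsto_nhds_unique (hlim W) ?_⟩
  rw [tendsto_iff_norm_sub_tendsto_zero]
  have hz : Tendsto (fun k : ℕ => c * (1 / 2 : ℝ) ^ k * ‖W'‖) atTop (𝓝 0) := by
    have := ((tendsto_pow_atTop_nhds_zero_of_lt_one (r := (1 / 2 : ℝ)) (by norm_num)
      (by norm_num)).const_mul c).mul_const ‖W'‖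
    simpa using this
  refine squeeze_zero (fun _ => norm_nonneg _) (fun k => ?_) hz
  rw [LinearMap.comp_apply, amp_eq h, norm_sub_rev]
  exact happ k W'

end

section
variable {T T' : Type*} [NormedAddCommGroup T] [InnerProductSpace ℂ T]
  [NormedAddCommGroup T'] [InnerProductSpace ℂ T']
  {t : H → K → T} {t' : H' → K' → T'}

lemma IsTensorEmbedding.norm (ht : IsTensorEmbedding t) (x : H) (y : K) :
    ‖t x y‖ = ‖x‖ * ‖y‖ := by
  have h := ht.2.2.2.2.1 x x y y
  simp only [inner_self_eq_norm_sq_to_K] at h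
  have h2 : ‖t x y‖ ^ 2 = (‖x‖ * ‖y‖) ^ 2 := by
    rw [mul_pow]
    exact_mod_cast h
  exact (pow_left_inj₀ (norm_nonneg _) (by positivity) two_ne_zero).1 h2

/-- `x ↦ x ⊗ y`. -/
def tS (ht : IsTensorEmbedding t) (y : K) : H →L[ℂ] T :=
  LinearMap.mkContinuous ⟨⟨fun x => t x y, fun a b => ht.1 a b y⟩, fun c a => ht.2.2.1 c a y⟩ ‖y‖
    (fun x => by simp [ht.norm, mul_comm])

/-- `y ↦ x ⊗ y`. -/
def tR (ht : IsTensorEmbedding t) (x : H) : K →L[ℂ] T :=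
  LinearMap.mkContinuous ⟨⟨fun y => t x y, fun a b => ht.2.1 x a b⟩, fun c a => ht.2.2.2.1 c x a⟩ ‖x‖
    (fun y => by simp [ht.norm])

@[simp] lemma tS_apply (ht : IsTensorEmbedding t) (y : K) (x : H) : tS ht y x = t x y := rfl
@[simp] lemma tR_apply (ht : IsTensorEmbedding t) (y : K) (x : H) : tR ht x y = t x y := rfl

lemma adj_tS [CompleteSpace H] [CompleteSpace T] (ht : IsTensorEmbedding t) (y' : K) (x : H)
    (y : K) : ContinuousLinearMap.adjoint (tS ht y') (t x y) = (⟪y', y⟫ : ℂ) • x := by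
  refine ext_inner_left ℂ fun v => ?_
  rw [ContinuousLinearMap.adjoint_inner_right, tS_apply, ht.2.2.2.2.1, inner_smul_right, mul_comm]

lemma isys_tS [CompleteSpace H] [CompleteSpace K] [CompleteSpace T] (ht : IsTensorEmbedding t)
    {ι : Type*} (b : HilbertBasis ι ℂ K) : ISys (fun i => tS ht (b i)) := by
  classical
  have ho : IOrth (fun i => tS ht (b i)) := by
    constructor
    · intro i x y
      have := orthonormal_iff_ite.1 b.orthonormal i i
      simp only [tS_apply, ht.2.2.2.2.1, this]
      simp
    · intro i j x y hij
      have := orthonormal_iff_ite.1 b.orthonormal i j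
      simp only [tS_apply, ht.2.2.2.2.1, this]
      simp [hij]
  refine ⟨ho, ?_⟩
  simp only [← pj_apply (L := fun i => tS ht (b i))]
  set P := pj (fun i => tS ht (b i)) with hP
  have hs : ∀ s ∈ Submodule.span ℂ { z | ∃ x y, z = t x y }, Tendsto (fun F => P F s) atTop (𝓝 s) := by
    intro s hs
    induction hs using Submodule.span_induction with
    | mem s h =>
      obtain ⟨x, y, rfl⟩ := h
      have h1 := (b.hasSum_repr y).mapL (tR ht x)
      have h2 : ∀ F, P F (t x y) = ∑ i ∈ F, tR ht x (b.repr y i • b i) := by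
        intro F
        rw [hP, pj_apply]
        refine Finset.sum_congr rfl fun i _ => ?_
        rw [adj_tS, tS_apply, tR_apply, ht.2.2.1, ht.2.2.2.1, b.repr_apply_apply]
      simp only [h2]
      simpa [HasSum] using h1
    | zero => simp
    | add a c _ _ ha hc => simpa using ha.add hc
    | smul r a _ ha => simpa using ha.const_smul r
  intro z
  rw [Metric.tendsto_nhds]
  intro ε hε
  have hz : z ∈ (Submodule.span ℂ { z | ∃ x y, z = t x y }).topologicalClosure := by
    rw [ht.2.2.2.2.2]; trivial
  obtain ⟨s, hs1, hs2⟩ := Metric.mem_closure_iff.1 hz (ε / 3) (by positivity)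
  filter_upwards [(Metric.tendsto_nhds.1 (hs s hs1)) (ε / 3) (by positivity)] with F hF
  have h1 : dist (P F z) (P F s) ≤ dist z s := by
    rw [dist_eq_norm, dist_eq_norm, ← map_sub]
    exact ho.norm_pj_le F _
  have h2 := dist_triangle4 (P F z) (P F s) s z
  have h3 := dist_comm s z
  linarith

lemma elem_block [CompleteSpace H] [CompleteSpace H'] [CompleteSpace T] [CompleteSpace T']
    (ht : IsTensorEmbedding t) (ht' : IsTensorEmbedding t') {W : T →L[ℂ] T'}
    {A : H →L[ℂ] H'} {B : K →L[ℂ] K'} (h : IsElemTensor t t' W A B) (y : K) (y' : K') :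
    cj (ContinuousLinearMap.adjoint (tS ht' y')) (tS ht y) W = (⟪y', B y⟫ : ℂ) • A := by
  ext x
  rw [cj_apply, tS_apply, h, adj_tS]
  rfl

/-- The isometry from the algebraic tensor product. -/
def tJ (ht : IsTensorEmbedding t) : TensorProduct ℂ H K →ₗᵢ[ℂ] T :=
  (TensorProduct.lift (LinearMap.mk₂ ℂ t ht.1 ht.2.2.1 ht.2.1
    (fun c x y => ht.2.2.2.1 c x y))).isometryOfInner (by
    intro a b
    induction a using TensorProduct.induction_on with
    | zero => simp
    | add a a' ha ha' => simp only [map_add, inner_add_left, ha, ha']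
    | tmul x y =>
      induction b using TensorProduct.induction_on with
      | zero => simp
      | add b b' hb hb' => simp only [map_add, inner_add_right, hb, hb']
      | tmul x' y' => simp [ht.2.2.2.2.1])

lemma tJ_tmul (ht : IsTensorEmbedding t) (x : H) (y : K) : tJ ht (TensorProduct.tmul ℂ x y) = t x y := by
  simp [tJ]

lemma dense_tJ (ht : IsTensorEmbedding t) : DenseRange (tJ ht) := by
  intro z
  have hz : z ∈ (Submodule.span ℂ { z | ∃ x y, z = t x y }).topologicalClosure := by
    rw [ht.2.2.2.2.2]; trivial
  have hle : Submodule.span ℂ { z | ∃ x y, z = t x y } ≤ LinearMap.range (tJ ht).toLinearMap := by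
    rw [Submodule.span_le]
    rintro _ ⟨x, y, rfl⟩
    exact ⟨TensorProduct.tmul ℂ x y, tJ_tmul ht x y⟩
  exact closure_mono (fun a ha => hle ha) hz

lemma exists_elem [CompleteSpace T'] (ht : IsTensorEmbedding t) (ht' : IsTensorEmbedding t')
    (A : H →L[ℂ] H') (B : K →L[ℂ] K') : ∃ W : T →L[ℂ] T', IsElemTensor t t' W A B := by
  refine ⟨ContinuousLinearMap.extend
    ((tJ ht').toContinuousLinearMap ∘L TensorProduct.mapL A B) (tJ ht).toContinuousLinearMap, ?_⟩
  intro x y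
  have h := ContinuousLinearMap.extend_eq
    ((tJ ht').toContinuousLinearMap ∘L TensorProduct.mapL A B)
    (e := (tJ ht).toContinuousLinearMap) (dense_tJ ht) (tJ ht).isometry.isUniformInducing
    (TensorProduct.tmul ℂ x y)
  have e1 : (tJ ht).toContinuousLinearMap (TensorProduct.tmul ℂ x y) = t x y := tJ_tmul ht x y
  rw [e1] at h
  rw [h]
  exact tJ_tmul ht' (A x) (B y)

/-- The key lemma: `ω ∘ (φ ⊗ id)` is a normal functional. -/
lemma exists_amp_tensor {H₂ K₂ T₂ : Type*} [NormedAddCommGroup H₂] [InnerProductSpace ℂ H₂]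
    [NormedAddCommGroup K₂] [InnerProductSpace ℂ K₂]
    [NormedAddCommGroup T₂] [InnerProductSpace ℂ T₂] [CompleteSpace H₂] [CompleteSpace K₂]
    [CompleteSpace T₂] {t₂ : H₂ → K₂ → T₂}
    [CompleteSpace H] [CompleteSpace K] [CompleteSpace T]
    (ht : IsTensorEmbedding t) (ht₂ : IsTensorEmbedding t₂)
    {φ : (H →L[ℂ] H₂) →ₗ[ℂ] (H →L[ℂ] H₂)} (hφ : WkContinuous φ) (hcb : CompletelyBounded φ)
    {ω : (T →L[ℂ] T₂) →ₗ[ℂ] ℂ} (hω : ω ∈ Nrm T T₂) :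
    ∃ Ω ∈ Nrm T T₂, ∀ A B W W', IsElemTensor t t₂ W A B → IsElemTensor t t₂ W' (φ A) B →
      Ω W = ω W' := by
  obtain ⟨_, b, _⟩ := exists_hilbertBasis ℂ K
  obtain ⟨_, b₂, _⟩ := exists_hilbertBasis ℂ K₂
  obtain ⟨Ω, hΩ, h⟩ := exists_amp (isys_tS ht b) (isys_tS ht₂ b₂) hφ hcb hω
  refine ⟨Ω, hΩ, fun A B W W' hW hW' => h W W' fun i j => ?_⟩
  rw [elem_block ht ht₂ hW, elem_block ht ht₂ hW', map_smul]

end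

section
variable {T T' : Type*} [NormedAddCommGroup T] [InnerProductSpace ℂ T]
  [NormedAddCommGroup T'] [InnerProductSpace ℂ T']
  {t : H → K → T} {t' : H' → K' → T'}

lemma wkClosure_mono {S S' : Set (H →L[ℂ] K)} (h : S ⊆ S') : wkClosure S ⊆ wkClosure S' :=
  @closure_mono _ (sigmaWeak H K) _ _ h

lemma subset_wkClosure' (S : Set (H →L[ℂ] K)) : S ⊆ wkClosure S :=
  @subset_closure _ (sigmaWeak H K) _

lemma wTensor_mono {V V' : Set (H →L[ℂ] H')} {U U' : Set (K →L[ℂ] K')} (hV : V ⊆ V')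
    (hU : U ⊆ U') : wTensor t t' V U ⊆ wTensor t t' V' U' := by
  refine wkClosure_mono (Submodule.span_mono ?_)
  rintro W ⟨S, hS, R, hR, h⟩
  exact ⟨S, hV hS, R, hU hR, h⟩

lemma eq_on_wkClosure {f g : (H →L[ℂ] K) → ℂ}
    (hf : @Continuous _ _ (sigmaWeak H K) _ f) (hg : @Continuous _ _ (sigmaWeak H K) _ g)
    {S : Set (H →L[ℂ] K)} (h : ∀ X ∈ S, f X = g X) {X : H →L[ℂ] K} (hX : X ∈ wkClosure S) :
    f X = g X := by
  letI := sigmaWeak H K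
  exact closure_minimal (s := S) (t := {X | f X = g X}) h (isClosed_eq hf hg) hX

lemma image_wkClosure {Φ : (H →L[ℂ] K) → (H →L[ℂ] K)} (hΦ : WkContinuous Φ)
    (S : Set (H →L[ℂ] K)) : Φ '' wkClosure S ⊆ wkClosure (Φ '' S) := by
  letI := sigmaWeak H K
  exact image_closure_subset_closure_image hΦ

lemma linear_eq_on_wTensor {ω ω' : (T →L[ℂ] T') →ₗ[ℂ] ℂ} (hω : ω ∈ Nrm T T')
    (hω' : ω' ∈ Nrm T T') {V : Set (H →L[ℂ] H')} {U : Set (K →L[ℂ] K')}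
    (h : ∀ A ∈ V, ∀ B ∈ U, ∀ W, IsElemTensor t t' W A B → ω W = ω' W) {X : T →L[ℂ] T'}
    (hX : X ∈ wTensor t t' V U) : ω X = ω' X := by
  refine eq_on_wkClosure (continuous_of_mem_Nrm hω) (continuous_of_mem_Nrm hω') ?_ hX
  intro Y hY
  have hle : Submodule.span ℂ { W | ∃ S ∈ V, ∃ R ∈ U, IsElemTensor t t' W S R } ≤
      LinearMap.eqLocus ω ω' := by
    rw [Submodule.span_le]
    rintro W ⟨A, hA, B, hB, hW⟩
    exact h A hA B hB W hW
  exact hle hY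

variable [CompleteSpace T']

lemma image_wTensor (ht : IsTensorEmbedding t) (ht' : IsTensorEmbedding t')
    {φ : (H →L[ℂ] H') → (H →L[ℂ] H')} {Φ : (T →L[ℂ] T') → (T →L[ℂ] T')}
    (hlin : IsLinearMap ℂ Φ) (hwk : WkContinuous Φ)
    (hΦ : ∀ (A : H →L[ℂ] H') (B : K →L[ℂ] K') (W W' : T →L[ℂ] T'),
      IsElemTensor t t' W A B → IsElemTensor t t' W' (φ A) B → Φ W = W')
    (V : Set (H →L[ℂ] H')) (U : Set (K →L[ℂ] K')) :
    Φ '' wTensor t t' V U ⊆ wTensor t t' (φ '' V) U := by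
  refine (image_wkClosure hwk _).trans (wkClosure_mono ?_)
  rintro _ ⟨X, hX, rfl⟩
  have hle : Submodule.span ℂ { W | ∃ S ∈ V, ∃ R ∈ U, IsElemTensor t t' W S R } ≤
      (Submodule.span ℂ { W | ∃ S ∈ φ '' V, ∃ R ∈ U, IsElemTensor t t' W S R }).comap
        (hlin.mk' Φ) := by
    rw [Submodule.span_le]
    rintro W ⟨A, hA, B, hB, hW⟩
    obtain ⟨W', hW'⟩ := exists_elem ht ht' (φ A) B
    refine Submodule.subset_span ⟨φ A, ⟨A, hA, rfl⟩, B, hB, ?_⟩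
    have : Φ W = W' := hΦ A B W W' hW hW'
    simpa [this] using hW'
  exact hle hX

lemma fix_wTensor
    {φ : (H →L[ℂ] H') → (H →L[ℂ] H')} (hφ : φ ∘ φ = φ) {Φ : (T →L[ℂ] T') → (T →L[ℂ] T')}
    (hlin : IsLinearMap ℂ Φ) (hwk : WkContinuous Φ)
    (hΦ : ∀ (A : H →L[ℂ] H') (B : K →L[ℂ] K') (W W' : T →L[ℂ] T'),
      IsElemTensor t t' W A B → IsElemTensor t t' W' (φ A) B → Φ W = W')
    {U : Set (K →L[ℂ] K')} {X : T →L[ℂ] T'} (hX : X ∈ wTensor t t' (Set.range φ) U) : Φ X = X := by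
  ext x
  refine ext_inner_left ℂ fun y => ?_
  have hle : Submodule.span ℂ { W | ∃ S ∈ Set.range φ, ∃ R ∈ U, IsElemTensor t t' W S R } ≤
      LinearMap.eqLocus (hlin.mk' Φ) LinearMap.id := by
    rw [Submodule.span_le]
    rintro W ⟨_, ⟨A, rfl⟩, B, hB, hW⟩
    refine hΦ (φ A) B W W hW ?_
    rwa [show φ (φ A) = φ A from congrFun hφ A]
  have hc := continuous_of_mem_Nrm (vf_mem (K := T') x y)
  refine eq_on_wkClosure (f := fun X => vf x y (Φ X)) (g := vf x y) ?_ hc ?_ hX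
  · exact @Continuous.comp _ _ _ (sigmaWeak T T') (sigmaWeak T T') _ Φ (vf x y) hc hwk
  · intro Y hY
    have : Φ Y = Y := hle hY
    simp only [this]

end

lemma hasSsigma_range [CompleteSpace H] [CompleteSpace K]
    (φ : (H →L[ℂ] K) →ₗ[ℂ] (H →L[ℂ] K)) (hφ : WkContinuous φ) (hcb : CompletelyBounded φ)
    (hid : ∀ A, φ (φ A) = φ A) : HasSsigma (Set.range φ) := by
  intro K₁ K₂ T₁ T₂ _ _ _ _ _ _ _ _ _ _ _ _ t₁ t₂ ht₁ ht₂ U _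
  refine Subset.antisymm ?_ (subset_inter (wTensor_mono subset_rfl (subset_univ _))
    (wTensor_mono (subset_univ _) subset_rfl))
  rintro X ⟨hX1, hX2⟩
  by_contra hX
  obtain ⟨ω, hω, h0, hne⟩ := exists_sep _ X hX
  obtain ⟨Ω, hΩ, hΩω⟩ := exists_amp_tensor ht₁ ht₂ hφ hcb hω
  have e1 : Ω X = ω X := by
    refine linear_eq_on_wTensor hΩ hω ?_ hX1
    rintro _ ⟨A, rfl⟩ B _ W hW
    exact hΩω (φ A) B W W hW (by rwa [hid])
  have e2 : Ω X = (0 : (T₁ →L[ℂ] T₂) →ₗ[ℂ] ℂ) X := by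
    refine linear_eq_on_wTensor hΩ (Submodule.zero_mem _) ?_ hX2
    rintro A _ B hB W hW
    obtain ⟨W', hW'⟩ := exists_elem ht₁ ht₂ (φ A) B
    rw [hΩω A B W W' hW hW', LinearMap.zero_apply]
    exact h0 W' (Submodule.subset_span ⟨φ A, ⟨A, rfl⟩, B, hB, hW'⟩)
  rw [e1] at e2
  exact hne (by simpa using e2)

end Helpers

end OpSynth




open scoped ComplexInnerProductSpace Pointwise
open Set OpSynth

/-- Lemma 2.1 / `l_pre`, `l_inphi`. -/
theorem statement0
    {H₁ H₂ K₁ K₂ T₁ T₂ : Type*}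
    [NormedAddCommGroup H₁] [InnerProductSpace ℂ H₁] [CompleteSpace H₁]
    [NormedAddCommGroup H₂] [InnerProductSpace ℂ H₂] [CompleteSpace H₂]
    [NormedAddCommGroup K₁] [InnerProductSpace ℂ K₁] [CompleteSpace K₁]
    [NormedAddCommGroup K₂] [InnerProductSpace ℂ K₂] [CompleteSpace K₂]
    [NormedAddCommGroup T₁] [InnerProductSpace ℂ T₁] [CompleteSpace T₁]
    [NormedAddCommGroup T₂] [InnerProductSpace ℂ T₂] [CompleteSpace T₂]
    (t₁ : H₁ → K₁ → T₁) (t₂ : H₂ → K₂ → T₂)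
    (ht₁ : IsTensorEmbedding t₁) (ht₂ : IsTensorEmbedding t₂)
    (φ : (H₁ →L[ℂ] H₂) → (H₁ →L[ℂ] H₂))
    (hφlin : IsLinearMap ℂ φ) (hφwk : WkContinuous φ)
    (hφcb : CompletelyBounded φ)
    {n : ℕ} (Vs : Fin n → Set (H₁ →L[ℂ] H₂)) (Us : Fin n → Set (K₁ →L[ℂ] K₂))
    (V : Set (H₁ →L[ℂ] H₂)) (U : Set (K₁ →L[ℂ] K₂))
    (hVs : ∀ i, IsWkClosedSubspace (Vs i)) (hUs : ∀ i, IsWkClosedSubspace (Us i))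
    (hV : IsWkClosedSubspace V) (hU : IsWkClosedSubspace U)
    (hinv : φ '' V ⊆ V)
    -- `Φ` is the induced map `φ̃ = φ ⊗ id`, characterized by its action on
    -- elementary tensors together with linearity and weak* continuity:
    (Φ : (T₁ →L[ℂ] T₂) → (T₁ →L[ℂ] T₂))
    (hΦlin : IsLinearMap ℂ Φ) (hΦwk : WkContinuous Φ)
    (hΦ : ∀ (A : H₁ →L[ℂ] H₂) (B : K₁ →L[ℂ] K₂) (W W' : T₁ →L[ℂ] T₂),
      IsElemTensor t₁ t₂ W A B → IsElemTensor t₁ t₂ W' (φ A) B → Φ W = W') :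
    -- (i)
    (Φ '' wkClosure (setSum fun i => wTensor t₁ t₂ (Vs i) (Us i)) ⊆
        wkClosure (setSum fun i => wTensor t₁ t₂ (wkClosure (φ '' Vs i)) (Us i))) ∧
    (Φ '' wTensor t₁ t₂ V U ⊆ wTensor t₁ t₂ V U) ∧
    -- (ii)
    (φ ∘ φ = φ →
      (wTensor t₁ t₂ (Set.range φ) U ∩ wTensor t₁ t₂ V U
          = wTensor t₁ t₂ (φ '' V) U) ∧
      wTensor t₁ t₂ (φ '' V) U = Φ '' wTensor t₁ t₂ V U ∧
      HasSsigma (Set.range φ)) := by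
  have hmap := fun V U => image_wTensor ht₁ ht₂ hΦlin hΦwk hΦ V U
  refine ⟨?_, ?_, ?_⟩
  · refine (image_wkClosure hΦwk _).trans (wkClosure_mono ?_)
    rintro _ ⟨_, ⟨f, hf, rfl⟩, rfl⟩
    refine ⟨fun i => Φ (f i), fun i => ?_, map_sum (hΦlin.mk' Φ) f _⟩
    exact wTensor_mono (subset_wkClosure' _) subset_rfl (hmap _ _ ⟨f i, hf i, rfl⟩)
  · exact (hmap V U).trans (wTensor_mono hinv subset_rfl)
  · intro hid
    refine ⟨?_, ?_, ?_⟩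
    · refine Subset.antisymm ?_ (subset_inter (wTensor_mono (image_subset_range _ _) subset_rfl)
        (wTensor_mono hinv subset_rfl))
      rintro X ⟨h1, h2⟩
      rw [← fix_wTensor hid hΦlin hΦwk hΦ h1]
      exact hmap V U ⟨X, h2, rfl⟩
    · refine Subset.antisymm (fun X hX => ?_) (hmap V U)
      exact ⟨X, wTensor_mono hinv subset_rfl hX, fix_wTensor hid hΦlin hΦwk hΦ
        (wTensor_mono (image_subset_range _ _) subset_rfl hX)⟩
    · exact hasSsigma_range (hφlin.mk' φ) hφwk hφcb (fun A => congrFun hid A)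
end
end

section
/- Let H₁ = ℓ² with standard orthonormal basis (e_i)_{i∈ℕ}, let P_i be the rank one projection onto the span of e_i, let H₂ be a Hilbert space, and let Q_i be an orthogonal projection on H₂ for each i ∈ ℕ. Then the weak* closed subspace V = {T ∈ B(H₁,H₂) : TP_i = Q_i T P_i for all i ∈ ℕ} possesses property S_σ. -/
open scoped ComplexInnerProductSpace Pointwise
open Set MeasureTheory

noncomputable section

open scoped ComplexInnerProductSpace Pointwise
open Set OpSynth

/-- The standard orthonormal basis `(e_i)` of `ℓ²`. -/
noncomputable def stdBasisVec (i : ℕ) : lp (fun _ : ℕ => ℂ) 2 :=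
  lp.single 2 i 1

/-- The rank one projection `P_i` whose range is spanned by `e_i`. -/
noncomputable def rankOneProj (i : ℕ) :
    lp (fun _ : ℕ => ℂ) 2 →L[ℂ] lp (fun _ : ℕ => ℂ) 2 :=
  (innerSL ℂ (stdBasisVec i)).smulRight (stdBasisVec i)

section Helpers

variable {H K H₁ H₂ K₁ K₂ T₁ T₂ : Type*}
  [NormedAddCommGroup H] [InnerProductSpace ℂ H]
  [NormedAddCommGroup K] [InnerProductSpace ℂ K]
  [NormedAddCommGroup H₁] [InnerProductSpace ℂ H₁]
  [NormedAddCommGroup H₂] [InnerProductSpace ℂ H₂]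
  [NormedAddCommGroup K₁] [InnerProductSpace ℂ K₁]
  [NormedAddCommGroup K₂] [InnerProductSpace ℂ K₂]
  [NormedAddCommGroup T₁] [InnerProductSpace ℂ T₁]
  [NormedAddCommGroup T₂] [InnerProductSpace ℂ T₂]

lemma aux_bound_summable {ξ : ℕ → H} {η : ℕ → K} (C : ℝ)
    (hξ : Summable fun n => ‖ξ n‖ ^ 2) (hη : Summable fun n => ‖η n‖ ^ 2) :
    Summable fun n => ‖η n‖ * (C * ‖ξ n‖) := by
  have h : Summable fun n => ‖η n‖ * ‖ξ n‖ := by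
    refine Summable.of_nonneg_of_le (fun n => by positivity) (fun n => ?_) (hξ.add hη)
    nlinarith [sq_nonneg (‖η n‖ - ‖ξ n‖), sq_nonneg (‖η n‖), sq_nonneg (‖ξ n‖)]
  refine (h.mul_left C).congr (fun n => by ring)

lemma aux_norm_le (T : H →L[ℂ] K) (x : H) (y : K) : ‖⟪y, T x⟫‖ ≤ ‖y‖ * (‖T‖ * ‖x‖) :=
  (norm_inner_le_norm _ _).trans (by gcongr; exact T.le_opNorm x)

lemma aux_summable {ξ : ℕ → H} {η : ℕ → K} (T : H →L[ℂ] K)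
    (hξ : Summable fun n => ‖ξ n‖ ^ 2) (hη : Summable fun n => ‖η n‖ ^ 2) :
    Summable fun n => ⟪η n, T (ξ n)⟫ :=
  Summable.of_norm_bounded (aux_bound_summable ‖T‖ hξ hη) (fun n => aux_norm_le _ _ _)

lemma aux_cont {ξ : ℕ → H} {η : ℕ → K}
    (hξ : Summable fun n => ‖ξ n‖ ^ 2) (hη : Summable fun n => ‖η n‖ ^ 2) :
    @Continuous _ _ (sigmaWeak H K) _ (fun T : H →L[ℂ] K => ∑' n, ⟪η n, T (ξ n)⟫) := by
  rw [continuous_iff_le_induced]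
  exact iInf_le_of_le ξ (iInf_le_of_le η (iInf_le_of_le hξ (iInf_le_of_le hη le_rfl)))

lemma aux_sq {x : H} : Summable fun n : ℕ => ‖(if n = 0 then x else 0)‖ ^ 2 :=
  summable_of_ne_finset_zero (s := {0}) (fun n hn => by
    have : n ≠ 0 := by simpa using hn
    simp [this])

lemma aux_cont_vec (x : H) (y : K) :
    @Continuous _ _ (sigmaWeak H K) _ (fun T : H →L[ℂ] K => ⟪y, T x⟫) := by
  have h := aux_cont (aux_sq (x := x)) (aux_sq (x := y))
  convert h using 2 with T
  rw [tsum_eq_single 0]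
  · simp
  · intro n hn
    simp [hn]

lemma aux_cont_rng {X : Type*} [tX : TopologicalSpace X] {f : X → (H →L[ℂ] K)}
    (h : ∀ (ξ : ℕ → H) (η : ℕ → K), (Summable fun n => ‖ξ n‖ ^ 2) →
      (Summable fun n => ‖η n‖ ^ 2) → Continuous fun x => ∑' n, ⟪η n, f x (ξ n)⟫) :
    @Continuous _ _ tX (sigmaWeak H K) f := by
  unfold sigmaWeak
  refine continuous_iInf_rng.2 fun ξ => continuous_iInf_rng.2 fun η =>
    continuous_iInf_rng.2 fun hξ => continuous_iInf_rng.2 fun hη => continuous_induced_rng.2 ?_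
  exact h ξ η hξ hη

lemma aux_tendsto {f : ℕ → (H →L[ℂ] K)} {T : H →L[ℂ] K}
    (h : ∀ (ξ : ℕ → H) (η : ℕ → K), (Summable fun n => ‖ξ n‖ ^ 2) →
      (Summable fun n => ‖η n‖ ^ 2) →
      Filter.Tendsto (fun N => ∑' n, ⟪η n, f N (ξ n)⟫) Filter.atTop
        (nhds (∑' n, ⟪η n, T (ξ n)⟫))) :
    Filter.Tendsto f Filter.atTop (@nhds _ (sigmaWeak H K) T) := by
  unfold sigmaWeak
  simp only [nhds_iInf, nhds_induced, Filter.tendsto_iInf, Filter.tendsto_comap_iff]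
  exact fun ξ η hξ hη => h ξ η hξ hη

lemma aux_sq_map (A : H →L[ℂ] K) {ξ : ℕ → H} (hξ : Summable fun n => ‖ξ n‖ ^ 2) :
    Summable fun n => ‖A (ξ n)‖ ^ 2 := by
  refine Summable.of_nonneg_of_le (fun n => by positivity) (fun n => ?_) (hξ.mul_left (‖A‖ ^ 2))
  rw [← mul_pow]
  gcongr
  exact A.le_opNorm _

/-- The compression map. -/
def auxPhi (E : ℕ → T₂ →L[ℂ] T₂) (P : ℕ → T₁ →L[ℂ] T₁) (N : ℕ) :
    (T₁ →L[ℂ] T₂) →ₗ[ℂ] (T₁ →L[ℂ] T₂) where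
  toFun T := ∑ i ∈ Finset.range N, E i ∘L T ∘L P i
  map_add' S T := by
    rw [← Finset.sum_add_distrib]
    refine Finset.sum_congr rfl fun i _ => ?_
    ext x; simp
  map_smul' c T := by
    simp only [RingHom.id_apply, Finset.smul_sum]
    refine Finset.sum_congr rfl fun i _ => ?_
    ext x; simp

lemma auxPhi_cont [CompleteSpace T₂] (E : ℕ → T₂ →L[ℂ] T₂) (P : ℕ → T₁ →L[ℂ] T₁) (N : ℕ) :
    WkContinuous (auxPhi E P N) := by
  unfold WkContinuous
  refine @aux_cont_rng _ _ _ _ _ _ _ (sigmaWeak T₁ T₂) _ fun ξ η hξ hη => ?_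
  have h : ∀ T : T₁ →L[ℂ] T₂, ∑' n, ⟪η n, auxPhi E P N T (ξ n)⟫ =
      ∑ i ∈ Finset.range N,
        ∑' n, ⟪(ContinuousLinearMap.adjoint (E i)) (η n), T (P i (ξ n))⟫ := by
    intro T
    rw [← Summable.tsum_finsetSum]
    · refine tsum_congr fun n => ?_
      simp [auxPhi, ContinuousLinearMap.sum_apply, inner_sum, ContinuousLinearMap.adjoint_inner_left]
    · intro i _
      exact aux_summable T (aux_sq_map (P i) hξ) (aux_sq_map _ hη)
  simp only [h]
  letI := sigmaWeak T₁ T₂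
  exact continuous_finset_sum _ fun i _ => aux_cont (aux_sq_map (P i) hξ) (aux_sq_map _ hη)

lemma aux_wTensor_mono {t₁ : H₁ → K₁ → T₁} {t₂ : H₂ → K₂ → T₂}
    {V V' : Set (H₁ →L[ℂ] H₂)} {U U' : Set (K₁ →L[ℂ] K₂)} (hV : V ⊆ V') (hU : U ⊆ U') :
    wTensor t₁ t₂ V U ⊆ wTensor t₁ t₂ V' U' := by
  refine @closure_mono _ (sigmaWeak T₁ T₂) _ _ ?_
  refine Submodule.span_mono ?_
  rintro W ⟨S, hS, R, hR, h⟩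
  exact ⟨S, hV hS, R, hU hR, h⟩

lemma aux_norm {t : H → K → T₁} (ht : IsTensorEmbedding t) (x : H) (y : K) :
    ‖t x y‖ = ‖x‖ * ‖y‖ := by
  have h := ht.2.2.2.2.1 x x y y
  rw [inner_self_eq_norm_sq_to_K, inner_self_eq_norm_sq_to_K, inner_self_eq_norm_sq_to_K] at h
  have h' : ‖t x y‖ ^ 2 = (‖x‖ * ‖y‖) ^ 2 := by
    rw [mul_pow]; exact_mod_cast h
  exact (sq_eq_sq₀ (by positivity) (by positivity)).1 h'

/-- The map `y ↦ e ⊗ y`. -/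
def auxJ {t : H → K → T₁} (ht : IsTensorEmbedding t) (e : H) : K →L[ℂ] T₁ :=
  LinearMap.mkContinuous
    { toFun := fun y => t e y
      map_add' := ht.2.1 e
      map_smul' := fun c y => ht.2.2.2.1 c e y } ‖e‖ (fun y => (aux_norm ht e y).le)

/-- The map `x ↦ x ⊗ y`. -/
def auxL {t : H → K → T₁} (ht : IsTensorEmbedding t) (y : K) : H →L[ℂ] T₁ :=
  LinearMap.mkContinuous
    { toFun := fun x => t x y
      map_add' := fun x x' => ht.1 x x' y
      map_smul' := fun c x => ht.2.2.1 c x y } ‖y‖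
    (fun x => ((aux_norm ht x y).trans (mul_comm _ _)).le)

lemma auxJ_apply {t : H → K → T₁} (ht : IsTensorEmbedding t) (e : H) (y : K) :
    auxJ ht e y = t e y := rfl

lemma auxL_apply {t : H → K → T₁} (ht : IsTensorEmbedding t) (x : H) (y : K) :
    auxL ht y x = t x y := rfl

/-- The operator `P_e ⊗ 1`. -/
def auxP [CompleteSpace K] [CompleteSpace T₁] {t : H → K → T₁} (ht : IsTensorEmbedding t)
    (e : H) : T₁ →L[ℂ] T₁ :=
  auxJ ht e ∘L ContinuousLinearMap.adjoint (auxJ ht e)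

lemma auxP_apply [CompleteSpace K] [CompleteSpace T₁] {t : H → K → T₁}
    (ht : IsTensorEmbedding t) (e x : H) (y : K) : auxP ht e (t x y) = t (⟪e, x⟫ • e) y := by
  have h : ContinuousLinearMap.adjoint (auxJ ht e) (t x y) = ⟪e, x⟫ • y := by
    refine ext_inner_left ℂ fun z => ?_
    rw [ContinuousLinearMap.adjoint_inner_right, auxJ_apply, ht.2.2.2.2.1, inner_smul_right]
  rw [auxP, ContinuousLinearMap.comp_apply, h, auxJ_apply, ht.2.2.2.1, ht.2.2.1]

lemma aux_sum_norm_le [CompleteSpace K] [CompleteSpace T₁] {t : H → K → T₁}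
    (ht : IsTensorEmbedding t) {e : ℕ → H} (he : Orthonormal ℂ e) (N : ℕ) (w : T₁) :
    ‖∑ i ∈ Finset.range N, auxP ht (e i) w‖ ≤ ‖w‖ := by
  have h1 : ∀ i j, ⟪auxP ht (e i) w, auxP ht (e j) w⟫ =
      if i = j then ⟪auxP ht (e i) w, w⟫ else 0 := by
    intro i j
    simp only [auxP, ContinuousLinearMap.comp_apply]
    rw [← ContinuousLinearMap.adjoint_inner_right (auxJ ht (e i)) _ w, auxJ_apply, auxJ_apply,
      ht.2.2.2.2.1, orthonormal_iff_ite.1 he i j]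
    split_ifs with hij
    · subst hij; simp
    · simp
  set v := ∑ i ∈ Finset.range N, auxP ht (e i) w with hv
  have h2 : ⟪v, v⟫ = ⟪v, w⟫ := by
    rw [hv, sum_inner, sum_inner]
    refine Finset.sum_congr rfl fun i hi => ?_
    rw [inner_sum]
    simp only [h1]
    rw [Finset.sum_ite_eq, if_pos hi]
  have h3 : ‖v‖ * ‖v‖ ≤ ‖v‖ * ‖w‖ := by
    rw [← sq]
    have := norm_inner_le_norm (𝕜 := ℂ) v w
    rw [← h2, inner_self_eq_norm_sq_to_K] at this
    simpa using this
  by_contra! hlt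
  have hpos : 0 < ‖v‖ := (norm_nonneg w).trans_lt hlt
  nlinarith

lemma aux_sum_tendsto [CompleteSpace K] [CompleteSpace T₁] {t : H → K → T₁}
    (ht : IsTensorEmbedding t) {e : ℕ → H} (he : Orthonormal ℂ e)
    (hs : ∀ x, Filter.Tendsto (fun N => ∑ i ∈ Finset.range N, ⟪e i, x⟫ • e i)
      Filter.atTop (nhds x)) (w : T₁) :
    Filter.Tendsto (fun N => ∑ i ∈ Finset.range N, auxP ht (e i) w) Filter.atTop (nhds w) := by
  have hspan : ∀ w ∈ Submodule.span ℂ { z | ∃ x y, z = t x y },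
      Filter.Tendsto (fun N => ∑ i ∈ Finset.range N, auxP ht (e i) w) Filter.atTop (nhds w) := by
    intro w hw
    induction hw using Submodule.span_induction with
    | mem z hz =>
      obtain ⟨x, y, rfl⟩ := hz
      have := ((auxL ht y).continuous.tendsto x).comp (hs x)
      refine this.congr fun N => ?_
      simp only [Function.comp_apply, map_sum, auxP_apply, auxL_apply]
    | zero => simp
    | add a b _ _ ha hb =>
      refine (ha.add hb).congr fun N => ?_
      rw [← Finset.sum_add_distrib]; simp
    | smul c a _ ha =>
      refine (ha.const_smul c).congr fun N => ?_
      rw [Finset.smul_sum]; simp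
  have hw : w ∈ closure ((Submodule.span ℂ { z | ∃ x y, z = t x y } : Submodule ℂ T₁) : Set T₁) := by
    rw [← Submodule.topologicalClosure_coe, ht.2.2.2.2.2]; trivial
  rw [Metric.tendsto_atTop]
  intro ε hε
  obtain ⟨w', hw', hd⟩ := Metric.mem_closure_iff.1 hw (ε / 3) (by positivity)
  obtain ⟨N₀, hN⟩ := Metric.tendsto_atTop.1 (hspan w' hw') (ε / 3) (by positivity)
  refine ⟨N₀, fun N hNN => ?_⟩
  have h1 := hN N hNN
  have h2 := aux_sum_norm_le ht he N (w - w')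
  simp only [map_sub, Finset.sum_sub_distrib] at h2
  rw [← dist_eq_norm, ← dist_eq_norm] at h2
  have h3 := dist_triangle4 (∑ i ∈ Finset.range N, auxP ht (e i) w)
    (∑ i ∈ Finset.range N, auxP ht (e i) w') w' w
  rw [dist_comm w' w] at h3
  linarith

lemma aux_exists_E [CompleteSpace H] [CompleteSpace T₁] {t : H → K → T₁}
    (ht : IsTensorEmbedding t) {q : H →L[ℂ] H} (hq : IsProj q) :
    ∃ E : T₁ →L[ℂ] T₁, ∀ x y, E (t x y) = t (q x) y := by
  let M : Submodule ℂ T₁ := (Submodule.span ℂ { z | ∃ x y, z = t (q x) y }).topologicalClosure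
  haveI : CompleteSpace M :=
    (Submodule.isClosed_topologicalClosure _).completeSpace_coe
  refine ⟨M.starProjection, fun x y => ?_⟩
  refine (Submodule.eq_starProjection_of_mem_orthogonal (K := M) (v := t (q x) y) ?_ ?_)
  · exact Submodule.le_topologicalClosure _ (Submodule.subset_span ⟨x, y, rfl⟩)
  · rw [Submodule.orthogonal_closure]
    have hd : t x y - t (q x) y = t (x - q x) y := by
      rw [← auxL_apply ht, ← auxL_apply ht, ← auxL_apply ht, map_sub]
    rw [hd, Submodule.mem_orthogonal]
    intro u hu
    induction hu using Submodule.span_induction with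
    | mem z hz =>
      obtain ⟨a, b, rfl⟩ := hz
      rw [ht.2.2.2.2.1]
      have h1 : ⟪q a, x - q x⟫ = 0 := by
        have h2 := hq.2.isSymmetric a (x - q x)
        have h3 : q (q x) = q x := congrArg (fun f : H →L[ℂ] H => f x) hq.1
        simp only [ContinuousLinearMap.coe_coe] at h2
        rw [h2]; simp [h3]
      rw [h1, zero_mul]
    | zero => simp
    | add a b _ _ ha hb => rw [inner_add_left, ha, hb, add_zero]
    | smul c a _ ha => rw [inner_smul_left, ha, mul_zero]

end Helpers

lemma aux_orthonormal : Orthonormal ℂ stdBasisVec := by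
  rw [orthonormal_iff_ite]
  intro i j
  rw [stdBasisVec, lp.inner_single_left]
  by_cases h : i = j
  · subst h; simp [stdBasisVec]
  · simp [stdBasisVec, h]

lemma aux_std_tendsto (x : lp (fun _ : ℕ => ℂ) 2) :
    Filter.Tendsto (fun N => ∑ i ∈ Finset.range N, ⟪stdBasisVec i, x⟫ • stdBasisVec i)
      Filter.atTop (nhds x) := by
  have h := (lp.hasSum_single (p := 2) (by norm_num) x).tendsto_sum_nat
  refine h.congr fun N => Finset.sum_congr rfl fun i _ => ?_
  rw [stdBasisVec, lp.inner_single_left, ← lp.single_smul]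
  simp

/-- Lemma `l_co`. -/
theorem statement2
    {H₂ : Type*} [NormedAddCommGroup H₂] [InnerProductSpace ℂ H₂] [CompleteSpace H₂]
    (Q : ℕ → H₂ →L[ℂ] H₂) (hQ : ∀ i, IsProj (Q i)) :
    HasSsigma { T : lp (fun _ : ℕ => ℂ) 2 →L[ℂ] H₂ |
      ∀ i : ℕ, T ∘L rankOneProj i = Q i ∘L (T ∘L rankOneProj i) } := by
  intro K₁ K₂ T₁ T₂ _ _ _ _ _ _ _ _ _ _ _ _ t₁ t₂ ht₁ ht₂ U hU
  apply Subset.antisymm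
  swap
  · exact subset_inter (aux_wTensor_mono subset_rfl (subset_univ _))
      (aux_wTensor_mono (subset_univ _) subset_rfl)
  rintro T ⟨hT₁, hT₂⟩
  choose E hE using fun i => aux_exists_E ht₂ (hQ i)
  let P : ℕ → T₁ →L[ℂ] T₁ := fun i => auxP ht₁ (stdBasisVec i)
  -- density of elementary tensors
  have hext : ∀ A B : T₁ →L[ℂ] T₂, (∀ x y, A (t₁ x y) = B (t₁ x y)) → A = B := by
    intro A B h
    refine ContinuousLinearMap.ext_on (s := { z | ∃ x y, z = t₁ x y }) ?_ ?_
    · exact Submodule.dense_iff_topologicalClosure_eq_top.2 ht₁.2.2.2.2.2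
    · rintro _ ⟨x, y, rfl⟩; exact h x y
  have hPT : ∀ i, E i ∘L T ∘L P i = T ∘L P i := by
    intro i
    ext w
    refine ext_inner_left ℂ fun z => ?_
    have hcl : @IsClosed _ (sigmaWeak T₁ T₂) {W : T₁ →L[ℂ] T₂ |
        ⟪ContinuousLinearMap.adjoint (E i) z, W (P i w)⟫ = ⟪z, W (P i w)⟫} :=
      @isClosed_eq _ _ _ (sigmaWeak T₁ T₂) _ _ _ (aux_cont_vec _ _) (aux_cont_vec _ _)
    have hsub : ∀ S : Set (T₁ →L[ℂ] T₂), T ∈ wkClosure S →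
        S ⊆ {W : T₁ →L[ℂ] T₂ |
        ⟪ContinuousLinearMap.adjoint (E i) z, W (P i w)⟫ = ⟪z, W (P i w)⟫} →
        T ∈ {W : T₁ →L[ℂ] T₂ |
        ⟪ContinuousLinearMap.adjoint (E i) z, W (P i w)⟫ = ⟪z, W (P i w)⟫} :=
      fun S hTS hs => Set.mem_of_subset_of_mem
        (@closure_minimal _ (sigmaWeak T₁ T₂) _ _ hs hcl) hTS
    suffices hs : _ by
      have := hsub _ hT₁ hs
      simpa [ContinuousLinearMap.adjoint_inner_left] using this
    · intro W hW
      have : E i ∘L W ∘L P i = W ∘L P i := by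
        induction hW using Submodule.span_induction with
        | mem W hW =>
          obtain ⟨S, hS, R, -, hW⟩ := hW
          refine hext _ _ fun x y => ?_
          have h := congrArg (fun f => f x) (hS i)
          simp only [ContinuousLinearMap.comp_apply, rankOneProj,
            ContinuousLinearMap.smulRight_apply, innerSL_apply_apply] at h
          simp only [ContinuousLinearMap.comp_apply, P, auxP_apply]
          rw [hW, hE, ← h]
        | zero => simp
        | add A B _ _ hA hB =>
          rw [ContinuousLinearMap.add_comp, ContinuousLinearMap.comp_add, hA, hB]
        | smul c A _ hA =>
          rw [ContinuousLinearMap.smul_comp, ContinuousLinearMap.comp_smul, hA]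
      have h2 := congrArg (fun f : T₁ →L[ℂ] T₂ => ⟪z, f w⟫) this
      simpa [ContinuousLinearMap.adjoint_inner_left] using h2
  have hΦ : ∀ N, auxPhi E P N T ∈ wTensor t₁ t₂ { T : lp (fun _ : ℕ => ℂ) 2 →L[ℂ] H₂ |
      ∀ i : ℕ, T ∘L rankOneProj i = Q i ∘L (T ∘L rankOneProj i) } U := by
    intro N
    letI := sigmaWeak T₁ T₂
    refine map_mem_closure (auxPhi_cont E P N) hT₂ ?_
    intro W hW
    refine (Submodule.span_le.2 ?_ : _ ≤ (Submodule.span ℂ _).comap (auxPhi E P N)) hW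
    rintro W ⟨S, -, R, hR, hW⟩
    rw [SetLike.mem_coe, Submodule.mem_comap]
    simp only [auxPhi, LinearMap.coe_mk, AddHom.coe_mk]
    refine Submodule.sum_mem _ fun i _ => Submodule.subset_span ?_
    refine ⟨Q i ∘L S ∘L rankOneProj i, ?_, R, hR, ?_⟩
    · intro j
      rw [← ContinuousLinearMap.comp_assoc (Q j), ← ContinuousLinearMap.comp_assoc (Q j)]
      ext x
      have hj : ⟪stdBasisVec i, stdBasisVec j⟫ = if i = j then (1 : ℂ) else 0 :=
        orthonormal_iff_ite.1 aux_orthonormal i j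
      simp only [ContinuousLinearMap.comp_apply, rankOneProj,
            ContinuousLinearMap.smulRight_apply, innerSL_apply_apply, map_smul, hj]
      split_ifs with hij
      · subst hij
        have h3 : Q i (Q i (S (stdBasisVec i))) = Q i (S (stdBasisVec i)) :=
          congrArg (fun f : H₂ →L[ℂ] H₂ => f (S (stdBasisVec i))) (hQ i).1
        simp [h3]
      · simp [hj, hij]
    · intro x y
      simp only [ContinuousLinearMap.comp_apply, P, auxP_apply]
      rw [hW, hE]
      rfl
  have hlim : Filter.Tendsto (fun N => auxPhi E P N T) Filter.atTop
      (@nhds _ (sigmaWeak T₁ T₂) T) := by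
    have hval : ∀ N w, auxPhi E P N T w = T (∑ i ∈ Finset.range N, P i w) := by
      intro N w
      simp only [auxPhi, LinearMap.coe_mk, AddHom.coe_mk, hPT, map_sum]
      simp [ContinuousLinearMap.sum_apply]
    refine aux_tendsto fun ξ η hξ hη => ?_
    refine tendsto_tsum_of_dominated_convergence (aux_bound_summable ‖T‖ hξ hη) ?_ ?_
    · intro n
      simp only [hval]
      exact Filter.Tendsto.inner tendsto_const_nhds ((T.continuous.tendsto _).comp
        (aux_sum_tendsto ht₁ aux_orthonormal aux_std_tendsto (ξ n)))
    · refine Filter.Eventually.of_forall fun N n => ?_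
      rw [hval]
      refine (aux_norm_le _ _ _).trans ?_
      gcongr
      exact aux_sum_norm_le ht₁ aux_orthonormal N (ξ n)
  letI := sigmaWeak T₁ T₂
  have := mem_closure_of_tendsto hlim (Filter.Eventually.of_forall hΦ)
  have hc : IsClosed (wTensor t₁ t₂ { T : lp (fun _ : ℕ => ℂ) 2 →L[ℂ] H₂ |
      ∀ i : ℕ, T ∘L rankOneProj i = Q i ∘L (T ∘L rankOneProj i) } U) := isClosed_closure
  rwa [hc.closure_eq] at this
end
end
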